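/- If G is a finite simple bipartite graph with nonempty edge set, then dst(J(G)) ≤ (ℓ(G)+1)/2, i.e., 2·dst(J(G)) ≤ ℓ(G) + 1. -/

import Mathlib

open SimpleGraph

namespace DS

variable {V : Type*}

/-- The set of edges of a matching presented by the endpoint functions `u`, `v`. -/
def omEdges {s : ℕ} (u v : Fin s → V) : Set (Sym2 V) := {e | ∃ i, e = s(u i, v i)}

/-- `(u, v)` describes a matching of size `s` in `G`: the `2s` endpoints are pairwise
distinct (so the edges are pairwise disjoint) and each pair `{u i, v i}` is an edge. -/
def IsMatchingPair (G : SimpleGraph V) {s : ℕ} (u v : Fin s → V) : Prop :=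
  Function.Injective (Sum.elim u v) ∧ ∀ i, G.Adj (u i) (v i)

/-- `(u, v)` describes an ordered matching: a matching such that `{u 1, …, u s}` is an
independent set and `{u i, v j} ∈ E(G)` implies `i ≤ j`. -/
def IsOrderedMatching (G : SimpleGraph V) {s : ℕ} (u v : Fin s → V) : Prop :=
  IsMatchingPair G u v ∧ (∀ i j, ¬ G.Adj (u i) (u j)) ∧
    ∀ i j, G.Adj (u i) (v j) → i ≤ j

/-- The matching number of `G`. -/
noncomputable def nu (G : SimpleGraph V) : ℕ :=
  sSup {s | ∃ u v : Fin s → V, IsMatchingPair G u v}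

/-- The ordered matching number of `G`. -/
noncomputable def nu0 (G : SimpleGraph V) : ℕ :=
  sSup {s | ∃ u v : Fin s → V, IsOrderedMatching G u v}

/-- A walk is `M`-alternating if its edges are alternately in `M` and not in `M`. -/
def IsAlt {G : SimpleGraph V} (M : Set (Sym2 V)) {a b : V} (w : G.Walk a b) : Prop :=
  List.Chain' (fun e f => (e ∈ M ↔ f ∉ M)) w.edges

/-- The walk `w` is nonempty and its first and last edges belong to `M`. -/
def FirstLastInM {G : SimpleGraph V} (M : Set (Sym2 V)) {a b : V} (w : G.Walk a b) : Prop :=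
  ∃ h : w.edges ≠ [], w.edges.head h ∈ M ∧ w.edges.getLast h ∈ M

/-- `w` is an `M`-admissible path for the vertex `x` (with respect to the ordered matching
presented by `(u, v)`): an `M`-alternating path with origin `x` whose first and last
edges are in `M`, each of whose edges has an end in `A = range u` and an end in
`B = range v`. -/
def IsAdmissible {G : SimpleGraph V} {s : ℕ} (u v : Fin s → V) {a b : V}
    (w : G.Walk a b) (x : V) : Prop :=
  a = x ∧ IsAlt (omEdges u v) w ∧ FirstLastInM (omEdges u v) w ∧
    ∀ e ∈ w.edges, ∃ i j, e = s(u i, v j)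

/-- `ℓ(x)`: the length of a longest `M`-admissible path for `x`. -/
noncomputable def ellv (G : SimpleGraph V) {s : ℕ} (u v : Fin s → V) (x : V) : ℕ :=
  sSup {n | ∃ (b : V) (w : G.Walk x b), IsAdmissible u v w x ∧ w.length = n}

/-- `ℓ(M)`: the length of a longest `M`-alternating path in `G`. -/
noncomputable def ellM (G : SimpleGraph V) (M : Set (Sym2 V)) : ℕ :=
  sSup {n | ∃ (a b : V) (w : G.Walk a b), IsAlt M w ∧ w.length = n}

/-- `ℓ₀(M) = max {ℓ(x) : x ∈ B}`. -/
noncomputable def ell0 (G : SimpleGraph V) {s : ℕ} (u v : Fin s → V) : ℕ :=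
  sSup {n | ∃ i : Fin s, ellv G u v (v i) = n}

/-- `ℓ₁(M) = max {ℓ(x) + ℓ(y) + 1 : {x, y} ∈ E(G[B])}` (with the convention that this
is `0` when `B` is independent, since `sSup ∅ = 0`). -/
noncomputable def ell1 (G : SimpleGraph V) {s : ℕ} (u v : Fin s → V) : ℕ :=
  sSup {n | ∃ i j : Fin s, G.Adj (v i) (v j) ∧ ellv G u v (v i) + ellv G u v (v j) + 1 = n}

/-- `ℓ(G) = min {ℓ(M) : M a maximum ordered matching of G}`. -/
noncomputable def ellG (G : SimpleGraph V) : ℕ :=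
  sInf {n | ∃ u v : Fin (nu0 G) → V, IsOrderedMatching G u v ∧ ellM G (omEdges u v) = n}

open MvPolynomial in
/-- The `n`-th symbolic power `J(G)^{(n)} = ⋂_{{u,v} ∈ E(G)} (x_u, x_v)^n` of the cover
ideal of `G`. -/
noncomputable def symbPow (K : Type*) [Field K] (G : SimpleGraph V) (n : ℕ) :
    Ideal (MvPolynomial V K) :=
  ⨅ (p : V × V) (_ : G.Adj p.1 p.2), (Ideal.span {X p.1, X p.2}) ^ n

/-- The cover ideal `J(G) = ⋂_{{u,v} ∈ E(G)} (x_u, x_v)`. -/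
noncomputable def coverIdeal (K : Type*) [Field K] (G : SimpleGraph V) :
    Ideal (MvPolynomial V K) :=
  symbPow K G 1

/-- `depth R/I`: the length of a maximal `R/I`-regular sequence contained in the maximal
homogeneous ideal `(x_1, …, x_r)` of `R = K[x_1, …, x_r]`. -/
noncomputable def depthQ (K : Type*) [Field K] (I : Ideal (MvPolynomial V K)) : ℕ :=
  sSup {n | ∃ rs : List (MvPolynomial V K), rs.length = n ∧
    (∀ f ∈ rs, f ∈ Ideal.span (Set.range (MvPolynomial.X : V → MvPolynomial V K))) ∧
    RingTheory.Sequence.IsRegular (MvPolynomial V K ⧸ I) rs}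

/-- The stability index of the symbolic depth function of `J(G)`:
`sdst(J(G)) = min {n₀ ≥ 1 : depth R/J(G)^{(n)} = r − ν₀(G) − 1 for all n ≥ n₀}`. -/
noncomputable def sdst (K : Type*) [Field K] [Fintype V] (G : SimpleGraph V) : ℕ :=
  sInf {n0 | 1 ≤ n0 ∧ ∀ n, n0 ≤ n →
    depthQ K (symbPow K G n) = Fintype.card V - nu0 G - 1}

/-- The stability index of the depth function of `J(G)`:
the least `n₀ ≥ 1` such that `depth R/J(G)^n` is constant for `n ≥ n₀` (hence equal to
its limit value). -/
noncomputable def dst (K : Type*) [Field K] [Fintype V] (G : SimpleGraph V) : ℕ :=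
  sInf {n0 | 1 ≤ n0 ∧ ∀ m n, n0 ≤ m → n0 ≤ n →
    depthQ K (coverIdeal K G ^ m) = depthQ K (coverIdeal K G ^ n)}

end DS

namespace DS

/-! ### Koszul cochains -/

section Koszul

open scoped Pointwise

variable {R ι : Type*} [CommRing R] [DecidableEq ι] {M : Type*} [AddCommGroup M] [Module R M]

/-- The sign of `y` relative to the finite set `F`, ordered by the rank function `ρ`. -/
def koszulSign (R : Type*) [CommRing R] {ι : Type*} (ρ : ι → ℕ) (y : ι) (F : Finset ι) : R :=
  (-1) ^ (F.filter fun k => ρ k < ρ y).card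

/-- The Koszul differential of the family `z` on cochains with values in `M`. -/
def koszulD (ρ : ι → ℕ) (z : ι → R) (c : Finset ι → M) (F : Finset ι) : M :=
  ∑ y ∈ F, (koszulSign R ρ y F * z y) • c (F.erase y)

omit [DecidableEq ι] in
lemma koszulSign_mul_self (ρ : ι → ℕ) (y : ι) (F : Finset ι) :
    koszulSign R ρ y F * koszulSign R ρ y F = 1 := by
  rw [koszulSign, ← pow_add, ← two_mul, pow_mul]
  simp

lemma koszulSign_erase_of_le (ρ : ι → ℕ) {y k : ι} (F : Finset ι) (h : ρ y ≤ ρ k) :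
    koszulSign R ρ y (F.erase k) = koszulSign R ρ y F := by
  rw [koszulSign, koszulSign, Finset.filter_erase, Finset.erase_eq_of_notMem]
  simp [h]

lemma koszulSign_erase_of_lt (ρ : ι → ℕ) {y k : ι} {F : Finset ι} (hk : k ∈ F)
    (h : ρ k < ρ y) : koszulSign R ρ y (F.erase k) = -koszulSign R ρ y F := by
  have hk' : k ∈ F.filter fun j => ρ j < ρ y := by simp [hk, h]
  rw [koszulSign, koszulSign, Finset.filter_erase, ← Finset.card_erase_add_one hk', pow_succ]
  simp

lemma koszulD_add (ρ : ι → ℕ) (z : ι → R) (c c' : Finset ι → M) (F : Finset ι) :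
    koszulD ρ z (c + c') F = koszulD ρ z c F + koszulD ρ z c' F := by
  simp [koszulD, Finset.sum_add_distrib]

lemma koszulD_sub (ρ : ι → ℕ) (z : ι → R) (c c' : Finset ι → M) (F : Finset ι) :
    koszulD ρ z (c - c') F = koszulD ρ z c F - koszulD ρ z c' F := by
  simp [koszulD, smul_sub, Finset.sum_sub_distrib]

lemma koszulD_smul (ρ : ι → ℕ) (z : ι → R) (a : R) (c : Finset ι → M) (F : Finset ι) :
    koszulD ρ z (a • c) F = a • koszulD ρ z c F := by
  simp [koszulD, Finset.smul_sum, smul_comm a]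

lemma koszulD_zero (ρ : ι → ℕ) (z : ι → R) (F : Finset ι) :
    koszulD ρ z (0 : Finset ι → M) F = 0 := by
  simp [koszulD]

lemma koszulD_comp {N : Type*} [AddCommGroup N] [Module R N] (ρ : ι → ℕ) (z : ι → R)
    (φ : M →ₗ[R] N) (c : Finset ι → M) (F : Finset ι) :
    koszulD ρ z (fun F => φ (c F)) F = φ (koszulD ρ z c F) := by
  simp [koszulD]

lemma koszulD_koszulD {ρ : ι → ℕ} (hρ : Function.Injective ρ) (z : ι → R)
    (c : Finset ι → M) (F : Finset ι) : koszulD ρ z (koszulD ρ z c) F = 0 := by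
  simp only [koszulD, Finset.smul_sum, smul_smul]
  rw [Finset.sum_sigma']
  refine Finset.sum_involution (fun p _ => ⟨p.2, p.1⟩) ?_ ?_ ?_ ?_
  · rintro ⟨y, k⟩ h
    simp only [Finset.mem_sigma, Finset.mem_erase] at h
    obtain ⟨hy, hk, hkF⟩ := h
    dsimp only
    rw [Finset.erase_right_comm (a := k) (b := y), ← add_smul]
    have hne : ρ k ≠ ρ y := fun h => hk (hρ h)
    rcases lt_or_gt_of_ne hne with h | h
    · rw [koszulSign_erase_of_le ρ F h.le, koszulSign_erase_of_lt ρ hkF h]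
      convert zero_smul R _ using 2
      ring
    · rw [koszulSign_erase_of_le ρ F h.le, koszulSign_erase_of_lt ρ hy h]
      convert zero_smul R _ using 2
      ring
  · rintro ⟨y, k⟩ h _ he
    simp only [Finset.mem_sigma, Finset.mem_erase] at h
    exact h.2.1 (by simpa using congrArg Sigma.fst he)
  · rintro ⟨y, k⟩ h
    simp only [Finset.mem_sigma, Finset.mem_erase] at h ⊢
    exact ⟨h.2.2, fun e => h.2.1 e.symm, h.1⟩
  · rintro ⟨y, k⟩ _
    rfl

/-- Contraction with the basis element indexed by `y`. -/
def koszulH (ρ : ι → ℕ) (y : ι) (c : Finset ι → M) (F : Finset ι) : M :=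
  if y ∈ F then 0 else koszulSign R ρ y F • c (insert y F)

lemma koszulH_homotopy {ρ : ι → ℕ} (hρ : Function.Injective ρ) (z : ι → R) (y : ι)
    (c : Finset ι → M) (F : Finset ι) :
    koszulD ρ z (koszulH (R := R) ρ y c) F + koszulH (R := R) ρ y (koszulD ρ z c) F
      = z y • c F := by
  by_cases hy : y ∈ F
  · rw [koszulH, if_pos hy, add_zero, koszulD, Finset.sum_eq_single_of_mem y hy]
    · rw [koszulH, if_neg (Finset.notMem_erase y F), Finset.insert_erase hy, smul_smul,
        koszulSign_erase_of_le ρ F le_rfl, mul_right_comm, koszulSign_mul_self, one_mul]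
    · intro k hk hne
      rw [koszulH, if_pos (Finset.mem_erase.2 ⟨hne.symm, hy⟩), smul_zero]
  · rw [koszulH, if_neg hy]
    simp only [koszulD]
    rw [Finset.sum_insert hy, Finset.erase_insert hy]
    have h1 : koszulSign R ρ y (insert y F) = koszulSign R ρ y F := by
      conv_rhs => rw [← Finset.erase_insert hy]
      rw [koszulSign_erase_of_le ρ _ le_rfl]
    rw [h1, smul_add, smul_smul, ← mul_assoc, koszulSign_mul_self, one_mul, add_left_comm,
      Finset.smul_sum, ← Finset.sum_add_distrib, Finset.sum_eq_zero, add_zero]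
    intro k hk
    have hky : k ≠ y := fun h => hy (h ▸ hk)
    rw [koszulH, if_neg (fun h => hy (Finset.mem_of_mem_erase h)), smul_smul, smul_smul,
      Finset.erase_insert_of_ne hky.symm, ← add_smul]
    have hne : ρ k ≠ ρ y := fun h => hky (hρ h)
    rcases lt_or_gt_of_ne hne with h | h
    · have h2 : koszulSign R ρ k (insert y F) = koszulSign R ρ k F := by
        conv_rhs => rw [← Finset.erase_insert hy]
        rw [koszulSign_erase_of_le ρ _ h.le]
      rw [h2, koszulSign_erase_of_lt ρ hk h]
      convert zero_smul R _ using 2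
      ring
    · have h2 : koszulSign R ρ k F = -koszulSign R ρ k (insert y F) := by
        conv_lhs => rw [← Finset.erase_insert hy]
        rw [koszulSign_erase_of_lt ρ (Finset.mem_insert_self y F) h]
      rw [h2, koszulSign_erase_of_le ρ _ h.le]
      convert zero_smul R _ using 2
      ring

/-- The cochain `c` is homogeneous of degree `i`. -/
def IsCochain (i : ℕ) (c : Finset ι → M) : Prop := ∀ F, c F ≠ 0 → F.card = i

/-- `c` is a coboundary in cohomological degree `i`. -/
def IsCobound (ρ : ι → ℕ) (z : ι → R) (i : ℕ) (c : Finset ι → M) : Prop :=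
  ∃ b : Finset ι → M, (∀ F, b F ≠ 0 → F.card + 1 = i) ∧ ∀ F, koszulD ρ z b F = c F

/-- The Koszul cohomology of the family `z` with values in `M` vanishes in degree `i`. -/
def KoszulVanish (ρ : ι → ℕ) (z : ι → R) (i : ℕ) (M : Type*) [AddCommGroup M] [Module R M] :
    Prop :=
  ∀ c : Finset ι → M, IsCochain i c → (∀ F, koszulD ρ z c F = 0) → IsCobound ρ z i c

lemma isCochain_koszulD {ρ : ι → ℕ} {z : ι → R} {i : ℕ} {c : Finset ι → M}
    (hc : IsCochain i c) : IsCochain (i + 1) (koszulD ρ z c) := by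
  intro F hF
  obtain ⟨y, hy, h⟩ := Finset.exists_ne_zero_of_sum_ne_zero hF
  have := hc (F.erase y) (fun h0 => h (by rw [h0, smul_zero]))
  rw [← this, Finset.card_erase_add_one hy]

/-- The coboundaries absorb multiplication of a cocycle by elements of the ideal spanned by
the family. -/
lemma isCobound_smul_of_mem_span {ρ : ι → ℕ} (hρ : Function.Injective ρ) {z : ι → R} {i : ℕ}
    {c : Finset ι → M} (hc : IsCochain i c) (hd : ∀ F, koszulD ρ z c F = 0)
    {g : R} (hg : g ∈ Ideal.span (Set.range z)) : IsCobound ρ z i (g • c) := by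
  induction hg using Submodule.span_induction with
  | mem x hx =>
    obtain ⟨y, rfl⟩ := hx
    refine ⟨koszulH (R := R) ρ y c, ?_, ?_⟩
    · intro F hF
      rw [koszulH] at hF
      split_ifs at hF with hy
      · exact absurd rfl hF
      · rw [← hc (insert y F) (fun h0 => hF (by rw [h0, smul_zero])),
          Finset.card_insert_of_notMem hy]
    · intro F
      have := koszulH_homotopy hρ z y c F
      rw [Pi.smul_apply, ← this, left_eq_add]
      simp [koszulH, hd]
  | zero => exact ⟨0, by simp, fun F => by simp [koszulD_zero]⟩
  | add x y _ _ hx hy =>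
    obtain ⟨b, hb, hb'⟩ := hx
    obtain ⟨e, he, he'⟩ := hy
    refine ⟨b + e, ?_, fun F => by rw [koszulD_add, hb', he', add_smul]; rfl⟩
    intro F hF
    by_cases h : b F = 0
    · exact he F (fun h' => hF (by simp [h, h']))
    · exact hb F h
  | smul a x _ hx =>
    obtain ⟨b, hb, hb'⟩ := hx
    refine ⟨a • b, ?_, fun F => ?_⟩
    · intro F hF
      exact hb F (fun h => hF (by simp [h]))
    · rw [koszulD_smul, hb']; simp [mul_smul]

omit [DecidableEq ι] in
/-- Choose preimages of a homogeneous cochain. -/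
lemma exists_lift_cochain {N : Type*} [AddCommGroup N] [Module R N] {φ : M →ₗ[R] N}
    (P : Finset ι → Prop) (c : Finset ι → N) (hs : ∀ F, ∃ m, φ m = c F)
    (hc : ∀ F, c F ≠ 0 → P F) :
    ∃ e : Finset ι → M, (∀ F, e F ≠ 0 → P F) ∧ ∀ F, φ (e F) = c F := by
  classical
  choose e he using hs
  refine ⟨fun F => if c F = 0 then 0 else e F, ?_, ?_⟩
  · intro F hF
    by_cases h : c F = 0
    · simp [h] at hF
    · exact hc F h
  · intro F
    by_cases h : c F = 0
    · simp [h]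
    · simp [h, he]

lemma exists_smul_of_mem_smul_top {f : R} {m : M} (h : (f • (⊤ : Submodule R M)).mkQ m = 0) :
    ∃ e, f • e = m := by
  rw [Submodule.mkQ_apply, Submodule.Quotient.mk_eq_zero,
    Submodule.mem_smul_pointwise_iff_exists] at h
  obtain ⟨e, -, he⟩ := h
  exact ⟨e, he⟩

lemma isCobound_of_smul {ρ : ι → ℕ} (hρ : Function.Injective ρ) {z : ι → R} {i : ℕ} {f : R}
    (hf : IsSMulRegular M f) (hV : ∀ j, j + 1 = i → KoszulVanish ρ z j (QuotSMulTop f M))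
    {c : Finset ι → M} (h : IsCobound ρ z i (f • c)) :
    IsCobound ρ z i c := by
  obtain ⟨b, hb, hb'⟩ := h
  rcases i with _ | j
  · refine ⟨0, by simp, fun F => ?_⟩
    have h0 : b = 0 := by
      funext F
      by_contra h
      exact absurd (hb F h) (by omega)
    have := hb' F
    rw [h0, koszulD_zero] at this
    rw [koszulD_zero]
    exact (hf (by simpa using this.symm)).symm
  · let π := (f • (⊤ : Submodule R M)).mkQ
    obtain ⟨e, he, he'⟩ := hV j rfl (fun F => π (b F))
      (fun F hF => by
        have := hb F (fun h => hF (by simp [h]))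
        omega)
      (fun F => by
        rw [koszulD_comp, hb', Pi.smul_apply, Submodule.mkQ_apply,
          Submodule.Quotient.mk_eq_zero]
        exact Submodule.smul_mem_pointwise_smul _ _ _ trivial)
    obtain ⟨e₁, he₁, he₁'⟩ := exists_lift_cochain (φ := π) (fun F => F.card + 1 = j) e
      (fun F => Submodule.mkQ_surjective _ (e F)) he
    have key : ∀ F, ∃ m, (LinearMap.lsmul R M f) m = (b - koszulD ρ z e₁) F := by
      intro F
      apply exists_smul_of_mem_smul_top
      rw [Pi.sub_apply, map_sub, ← koszulD_comp, sub_eq_zero]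
      have : (fun F => (f • (⊤ : Submodule R M)).mkQ (e₁ F)) = e := funext he₁'
      rw [this, he']
    obtain ⟨g, hg, hg'⟩ := exists_lift_cochain (fun F => F.card + 1 = j + 1) _ key (by
      intro F hF
      by_cases h : b F = 0
      · have h2 : koszulD ρ z e₁ F ≠ 0 := fun h0 => hF (by simp [h, h0])
        have h3 := isCochain_koszulD (ρ := ρ) (z := z) (i := j - 1) (c := e₁) (fun F hF => by
          have := he₁ F hF; omega) F h2
        obtain ⟨y, hy, h⟩ := Finset.exists_ne_zero_of_sum_ne_zero h2
        have := he₁ (F.erase y) (fun h0 => h (by rw [h0, smul_zero]))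
        omega
      · exact hb F h)
    refine ⟨g, hg, fun F => hf ?_⟩
    have h1 : f • g = b - koszulD ρ z e₁ := funext hg'
    change f • koszulD ρ z g F = f • c F
    rw [← koszulD_smul, h1, koszulD_sub, hb', koszulD_koszulD hρ, sub_zero]
    rfl

/-- If `f` is a nonzerodivisor on `M` in the radical of the ideal spanned by `z`, then vanishing
for `M / f M` in degree `i - 1` gives vanishing for `M` in degree `i`. -/
lemma KoszulVanish.of_quotSMulTop {ρ : ι → ℕ} (hρ : Function.Injective ρ) {z : ι → R} {i : ℕ}
    {f : R} (hf : IsSMulRegular M f) (hfz : f ∈ (Ideal.span (Set.range z)).radical)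
    (hV : ∀ j, j + 1 = i → KoszulVanish ρ z j (QuotSMulTop f M)) : KoszulVanish ρ z i M := by
  intro c hc hd
  obtain ⟨n, hn⟩ := hfz
  have h := isCobound_smul_of_mem_span hρ hc hd hn
  clear hn
  induction n with
  | zero => simpa using h
  | succ n ih =>
    apply ih
    apply isCobound_of_smul hρ hf hV
    rwa [smul_smul, ← pow_succ']

/-- A weakly regular sequence in the radical of the ideal spanned by `z` forces vanishing of
the Koszul cohomology below its length. -/
theorem koszulVanish_of_isWeaklyRegular {ρ : ι → ℕ} (hρ : Function.Injective ρ) {z : ι → R}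
    (rs : List R) {M : Type*} [AddCommGroup M] [Module R M]
    (hrs : RingTheory.Sequence.IsWeaklyRegular M rs)
    (hz : ∀ f ∈ rs, f ∈ (Ideal.span (Set.range z)).radical) {i : ℕ} (hi : i < rs.length) :
    KoszulVanish ρ z i M := by
  induction rs generalizing M i with
  | nil => simp at hi
  | cons f rs ih =>
    rw [RingTheory.Sequence.isWeaklyRegular_cons_iff] at hrs
    refine KoszulVanish.of_quotSMulTop hρ hrs.1 (hz f (by simp)) fun j hj => ?_
    refine ih hrs.2 (fun g hg => hz g (by simp [hg])) ?_
    simp at hi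
    omega

/-- Vanishing in degrees `i` and `i + 1` for `M` gives vanishing in degree `i` for `M / f M`. -/
lemma KoszulVanish.quotSMulTop {ρ : ι → ℕ} (hρ : Function.Injective ρ) {z : ι → R} {i : ℕ}
    {f : R} (hf : IsSMulRegular M f) (h₀ : KoszulVanish ρ z i M)
    (h₁ : KoszulVanish ρ z (i + 1) M) : KoszulVanish ρ z i (QuotSMulTop f M) := by
  intro c hc hd
  let π := (f • (⊤ : Submodule R M)).mkQ
  obtain ⟨c₁, hc₁, hc₁'⟩ := exists_lift_cochain (φ := π) (fun F => F.card = i) c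
    (fun F => Submodule.mkQ_surjective _ (c F)) hc
  have hπ : (fun F => π (c₁ F)) = c := funext hc₁'
  obtain ⟨e, he, he'⟩ := exists_lift_cochain (φ := LinearMap.lsmul R M f)
    (fun F => F.card = i + 1) (koszulD ρ z c₁) (fun F => by
      apply exists_smul_of_mem_smul_top
      rw [← koszulD_comp]
      exact (congrFun (congrArg (koszulD ρ z) hπ) F).trans (hd F))
    (isCochain_koszulD hc₁)
  have hfe : f • e = koszulD ρ z c₁ := funext he'
  obtain ⟨g, hg, hg'⟩ := h₁ e he (fun F => hf (by
    change f • koszulD ρ z e F = f • 0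
    rw [← koszulD_smul, hfe, koszulD_koszulD hρ, smul_zero]))
  obtain ⟨b, hb, hb'⟩ := h₀ (c₁ - f • g) (fun F hF => by
      by_cases h : c₁ F = 0
      · have := hg F (fun h0 => hF (by simp [h, h0]))
        omega
      · exact hc₁ F h)
    (fun F => by
      rw [koszulD_sub, koszulD_smul, hg', sub_eq_zero]
      exact congrFun hfe.symm F)
  refine ⟨fun F => π (b F), fun F hF => hb F (fun h => hF (by simp [h])), fun F => ?_⟩
  rw [koszulD_comp, hb', Pi.sub_apply, map_sub, hc₁', sub_eq_self, Submodule.mkQ_apply,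
    Submodule.Quotient.mk_eq_zero]
  exact Submodule.smul_mem_pointwise_smul _ _ _ trivial

/-- Vanishing of the Koszul cohomology below `t` produces a weakly regular sequence of
length `t` in the ideal spanned by the family. -/
theorem exists_isWeaklyRegular_of_koszulVanish [IsNoetherianRing R] {ρ : ι → ℕ}
    (hρ : Function.Injective ρ) {z : ι → R} (t : ℕ) {M : Type*} [AddCommGroup M] [Module R M]
    [Module.Finite R M] (hV : ∀ i < t, KoszulVanish ρ z i M) :
    ∃ rs : List R, rs.length = t ∧ (∀ f ∈ rs, f ∈ Ideal.span (Set.range z)) ∧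
      RingTheory.Sequence.IsWeaklyRegular M rs := by
  induction t generalizing M with
  | zero => exact ⟨[], rfl, by simp, .nil R M⟩
  | succ t ih =>
    obtain ⟨f, hfz, hf⟩ : ∃ f ∈ Ideal.span (Set.range z), IsSMulRegular M f := by
      by_contra! hcon
      have hsub : ((Ideal.span (Set.range z) : Ideal R) : Set R) ⊆
          ⋃ p ∈ associatedPrimes R M, (p : Set R) := by
        rw [biUnion_associatedPrimes_eq_zero_divisors]
        intro f hf
        have := hcon f hf
        rw [isSMulRegular_iff_right_eq_zero_of_smul] at this
        push Not at this
        obtain ⟨x, hx, hx0⟩ := this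
        exact ⟨x, hx0, hx⟩
      obtain ⟨p, hp, hle⟩ := (Ideal.subset_union_prime_finite (associatedPrimes.finite R M)
        (f := id) 0 0 fun _ h _ _ => h.1).1 hsub
      rw [AssociatedPrimes.mem_iff, isAssociatedPrime_iff] at hp
      obtain ⟨hp', x, hx⟩ := hp
      have hxz : ∀ y, z y • x = 0 := by
        intro y
        have : z y ∈ p := hle (Ideal.subset_span ⟨y, rfl⟩)
        rwa [hx, Submodule.mem_colon_singleton] at this
      have hx0 : x = 0 := by
        obtain ⟨b, hb, hb'⟩ := hV 0 (by omega) (fun F => if F = ∅ then x else 0)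
          (fun F hF => by
            by_cases h : F = ∅
            · simp [h]
            · simp [h] at hF)
          (fun F => Finset.sum_eq_zero fun y hy => by
            dsimp only
            split_ifs
            · rw [mul_smul, hxz, smul_zero]
            · rw [smul_zero])
        have := hb' ∅
        simpa [koszulD] using this.symm
      apply hp'.ne_top
      rw [hx, hx0]
      simp
    obtain ⟨rs, hl, hm, hr⟩ := ih (M := QuotSMulTop f M) fun i hi =>
      KoszulVanish.quotSMulTop hρ hf (hV i (by omega)) (hV (i + 1) (by omega))
    refine ⟨f :: rs, by simp [hl], ?_, hr.cons hf⟩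
    intro g hg
    rcases List.mem_cons.1 hg with rfl | hg
    · exact hfz
    · exact hm g hg

end Koszul

end DS

namespace DS

/-! ### Koszul vanishing for quotients by ideals, elementwise -/

section IdealVanish

variable {R ι : Type*} [CommRing R] [DecidableEq ι]

/-- The Koszul cohomology of `z` with values in `R ⧸ I` vanishes in degree `i`, expressed through
representatives in `R`. -/
def IdealVanish (ρ : ι → ℕ) (z : ι → R) (i : ℕ) (I : Ideal R) : Prop :=
  ∀ c : Finset ι → R, IsCochain i c → (∀ F, koszulD ρ z c F ∈ I) →
    ∃ b : Finset ι → R, (∀ F, b F ≠ 0 → F.card + 1 = i) ∧ ∀ F, koszulD ρ z b F - c F ∈ I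

lemma koszulD_mem (ρ : ι → ℕ) (z : ι → R) {I : Ideal R} {c : Finset ι → R}
    (hc : ∀ F, c F ∈ I) (F : Finset ι) : koszulD ρ z c F ∈ I :=
  Ideal.sum_mem _ fun _ _ => Ideal.mul_mem_left _ _ (hc _)

lemma IdealVanish.koszulVanish {ρ : ι → ℕ} {z : ι → R} {i : ℕ} {I : Ideal R}
    (h : IdealVanish ρ z i I) : KoszulVanish ρ z i (R ⧸ I) := by
  intro c hc hd
  obtain ⟨c₁, hc₁, hc₁'⟩ := exists_lift_cochain (φ := I.mkQ) (fun F => F.card = i) c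
    (fun F => Submodule.mkQ_surjective _ (c F)) hc
  have hI : (fun F => I.mkQ (c₁ F)) = c := funext hc₁'
  obtain ⟨b, hb, hb'⟩ := h c₁ hc₁ fun F => by
    rw [← Submodule.Quotient.mk_eq_zero I, ← Submodule.mkQ_apply, ← koszulD_comp]
    exact (congrFun (congrArg (koszulD ρ z) hI) F).trans (hd F)
  refine ⟨fun F => I.mkQ (b F), fun F hF => hb F (fun h => hF (by simp [h])), fun F => ?_⟩
  rw [koszulD_comp, ← hc₁', ← sub_eq_zero, ← map_sub, Submodule.mkQ_apply,
    Submodule.Quotient.mk_eq_zero]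
  exact hb' F

lemma IdealVanish.top (ρ : ι → ℕ) (z : ι → R) (i : ℕ) : IdealVanish ρ z i (⊤ : Ideal R) :=
  fun _ _ _ => ⟨0, by simp, fun _ => Submodule.mem_top⟩

omit [DecidableEq ι] in
/-- Write a homogeneous cochain with values in `I + (f)` as a sum, homogeneously. -/
lemma exists_cochain_decomp {I I₂ : Ideal R} {f : R} (h₂ : ∀ g ∈ I₂, ∃ r, g - f * r ∈ I) {i : ℕ}
    {c : Finset ι → R} (hc : IsCochain i c) (hcI : ∀ F, c F ∈ I₂) :
    ∃ g : Finset ι → R, IsCochain i g ∧ ∀ F, c F - f * g F ∈ I := by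
  classical
  choose g hg using fun F => h₂ _ (hcI F)
  refine ⟨fun F => if F.card = i then g F else 0, ?_, ?_⟩
  · intro F hF
    by_contra h
    simp [h] at hF
  · intro F
    by_cases h : F.card = i
    · simpa [h] using hg F
    · have : c F = 0 := by
        by_contra h0
        exact h (hc F h0)
      simp [h, this]

/-- Vanishing for `R ⧸ (I : f)` and for `R ⧸ (I + (f))` gives vanishing for `R ⧸ I`. -/
lemma IdealVanish.of_colon_of_sup {ρ : ι → ℕ} (hρ : Function.Injective ρ) {z : ι → R} {i : ℕ}
    {I I₁ I₂ : Ideal R} {f : R} (h₁ : ∀ g, f * g ∈ I ↔ g ∈ I₁) (hle : I ≤ I₂)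
    (h₂ : ∀ g ∈ I₂, ∃ r, g - f * r ∈ I) (hV₁ : IdealVanish ρ z i I₁)
    (hV₂ : IdealVanish ρ z i I₂) : IdealVanish ρ z i I := by
  intro c hc hd
  obtain ⟨b, hb, hb'⟩ := hV₂ c hc fun F => hle (hd F)
  have hbc : IsCochain i (koszulD ρ z b - c) := by
    intro F hF
    by_cases h : c F = 0
    · have h2 : koszulD ρ z b F ≠ 0 := fun h0 => hF (by simp [h, h0])
      obtain ⟨y, hy, h⟩ := Finset.exists_ne_zero_of_sum_ne_zero h2
      have := hb (F.erase y) (fun h0 => h (by rw [h0, smul_zero]))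
      rwa [Finset.card_erase_add_one hy] at this
    · exact hc F h
  obtain ⟨g, hg, hg'⟩ := exists_cochain_decomp h₂ hbc hb'
  obtain ⟨e, he, he'⟩ := hV₁ g hg fun F => by
    rw [← h₁]
    have h := koszulD_mem ρ z (c := koszulD ρ z b - c - f • g) hg' F
    rw [koszulD_sub, koszulD_sub, koszulD_koszulD hρ, koszulD_smul, zero_sub] at h
    have := I.neg_mem (I.add_mem h (hd F))
    convert this using 1
    simp only [smul_eq_mul]
    ring
  refine ⟨b - f • e, ?_, fun F => ?_⟩
  · intro F hF
    by_cases h : b F = 0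
    · exact he F (fun h' => hF (by simp [h, h']))
    · exact hb F h
  · have h := I.sub_mem (hg' F) ((h₁ _).2 (he' F))
    convert h using 1
    simp only [koszulD_sub, koszulD_smul, Pi.sub_apply, smul_eq_mul]
    ring

/-- If `z y` is a nonzerodivisor modulo `I`, vanishing for `I + (z y)` in degree `i - 1` gives
vanishing for `I` in degree `i`. -/
lemma IdealVanish.of_regular {ρ : ι → ℕ} (hρ : Function.Injective ρ) {z : ι → R} {i : ℕ}
    {I I₂ : Ideal R} {y : ι} (h₁ : ∀ g, z y * g ∈ I → g ∈ I) (hle : I ≤ I₂) (hy : z y ∈ I₂)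
    (h₂ : ∀ g ∈ I₂, ∃ r, g - z y * r ∈ I) (hV : ∀ j, j + 1 = i → IdealVanish ρ z j I₂) :
    IdealVanish ρ z i I := by
  intro c hc hd
  have hhd : ∀ F, koszulH (R := R) ρ y (koszulD ρ z c) F ∈ I := by
    intro F
    rw [koszulH]
    split_ifs
    · exact I.zero_mem
    · exact Ideal.mul_mem_left _ _ (hd _)
  have hH : ∀ F, koszulH (R := R) ρ y c F ≠ 0 → F.card + 1 = i := by
    intro F hF
    rw [koszulH] at hF
    split_ifs at hF with hy
    · exact absurd rfl hF
    · rw [← hc (insert y F) (fun h0 => hF (by rw [h0, smul_zero])),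
        Finset.card_insert_of_notMem hy]
  have hom := koszulH_homotopy hρ z y c
  rcases i with _ | j
  · refine ⟨0, by simp, fun F => ?_⟩
    have h0 : koszulH (R := R) ρ y c = 0 := by
      funext F
      by_contra h
      exact absurd (hH F h) (by omega)
    rw [koszulD_zero, zero_sub]
    apply I.neg_mem
    apply h₁
    have := hom F
    rw [h0, koszulD_zero, zero_add] at this
    rw [← smul_eq_mul, ← this]
    exact hhd F
  · have hH' : IsCochain j (koszulH (R := R) ρ y c) := fun F hF => by
      have := hH F hF
      omega
    obtain ⟨b, hb, hb'⟩ := hV j rfl _ hH' fun F => by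
      have : koszulD ρ z (koszulH (R := R) ρ y c) F
          = c F * z y - koszulH (R := R) ρ y (koszulD ρ z c) F := by
        rw [eq_sub_iff_add_eq, hom, smul_eq_mul, mul_comm]
      rw [this]
      exact I₂.sub_mem (I₂.mul_mem_left _ hy) (hle (hhd F))
    have hbc : IsCochain j (koszulD ρ z b - koszulH (R := R) ρ y c) := by
      intro F hF
      by_cases h : koszulH (R := R) ρ y c F = 0
      · have h2 : koszulD ρ z b F ≠ 0 := fun h0 => hF (by simp [h, h0])
        obtain ⟨y, hy, h⟩ := Finset.exists_ne_zero_of_sum_ne_zero h2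
        have := hb (F.erase y) (fun h0 => h (by rw [h0, smul_zero]))
        rwa [Finset.card_erase_add_one hy] at this
      · exact hH' F h
    obtain ⟨g, hg, hg'⟩ := exists_cochain_decomp h₂ hbc hb'
    refine ⟨-g, fun F hF => ?_, fun F => ?_⟩
    · have := hg F (fun h => hF (by simp [h]))
      omega
    · apply h₁
      have h := koszulD_mem ρ z (c := koszulD ρ z b - koszulH (R := R) ρ y c - z y • g) hg' F
      rw [koszulD_sub, koszulD_sub, koszulD_koszulD hρ, koszulD_smul] at h
      have h' := I.sub_mem h (hhd F)
      have hn : koszulD ρ z (-g) F = -koszulD ρ z g F := by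
        simpa using koszulD_smul ρ z (-1) g F
      have hF := hom F
      rw [smul_eq_mul] at hF h'
      convert h' using 1
      rw [hn, mul_sub, ← hF]
      ring

end IdealVanish

/-! ### Monomial ideals -/

section Monomial

open MvPolynomial

variable {V : Type*} (K : Type*) [Field K]

/-- Koszul vanishing with respect to the variables, modulo the monomial ideal with set of
exponents `S`. -/
def MonoVanish [DecidableEq V] (ρ : V → ℕ) (i : ℕ) (S : Set (V →₀ ℕ)) : Prop :=
  ∀ hS : IsUpperSet S,
    IdealVanish ρ (X : V → MvPolynomial V K) i (restrictSupportIdeal K S hS)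

variable {K}

lemma mem_monoIdeal {S : Set (V →₀ ℕ)} {hS : IsUpperSet S} {f : MvPolynomial V K} :
    f ∈ restrictSupportIdeal K S hS ↔ ∀ m, f.coeff m ≠ 0 → m ∈ S := by
  simp only [← mem_support_iff]
  exact Iff.rfl

lemma monomial_mem_monoIdeal {S : Set (V →₀ ℕ)} {hS : IsUpperSet S} {m : V →₀ ℕ} (a : K)
    (hm : m ∈ S) : monomial m a ∈ restrictSupportIdeal K S hS := by
  classical
  rw [mem_monoIdeal]
  intro k hk
  rw [coeff_monomial] at hk
  split_ifs at hk with h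
  · exact h ▸ hm
  · exact absurd rfl hk

lemma monomial_mul_mem_monoIdeal {S : Set (V →₀ ℕ)} {hS : IsUpperSet S} (e : V →₀ ℕ)
    (hS' : IsUpperSet {m | e + m ∈ S}) (g : MvPolynomial V K) :
    monomial e 1 * g ∈ restrictSupportIdeal K S hS ↔
      g ∈ restrictSupportIdeal K {m | e + m ∈ S} hS' := by
  classical
  rw [mem_monoIdeal, mem_monoIdeal]
  constructor
  · intro h m hm
    exact h (e + m) (by rwa [coeff_monomial_mul, one_mul])
  · intro h m hm
    rw [coeff_monomial_mul'] at hm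
    split_ifs at hm with hle
    · rw [one_mul] at hm
      simpa [add_tsub_cancel_of_le hle] using h _ hm
    · exact absurd rfl hm

lemma exists_sub_monomial_mul_mem {S : Set (V →₀ ℕ)} {hS : IsUpperSet S} (e : V →₀ ℕ)
    {hS' : IsUpperSet (S ∪ Set.Ici e)} {g : MvPolynomial V K}
    (hg : g ∈ restrictSupportIdeal K (S ∪ Set.Ici e) hS') :
    ∃ r, g - monomial e 1 * r ∈ restrictSupportIdeal K S hS := by
  have : g ∈ restrictSupportIdeal K S hS ⊔ Ideal.span {monomial e 1} := by
    rw [g.as_sum]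
    refine Ideal.sum_mem _ fun m hm => ?_
    rcases mem_monoIdeal.1 hg m (mem_support_iff.1 hm) with h | h
    · exact Ideal.mem_sup_left (monomial_mem_monoIdeal _ h)
    · refine Ideal.mem_sup_right (Ideal.mem_span_singleton'.2 ⟨monomial (m - e) (g.coeff m), ?_⟩)
      rw [monomial_mul, mul_one, tsub_add_cancel_of_le h]
  obtain ⟨a, ha, b, hb, rfl⟩ := Submodule.mem_sup.1 this
  obtain ⟨r, rfl⟩ := Ideal.mem_span_singleton.1 hb
  exact ⟨r, by simpa using ha⟩

lemma isUpperSet_colon {S : Set (V →₀ ℕ)} (hS : IsUpperSet S) (e : V →₀ ℕ) :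
    IsUpperSet {m | e + m ∈ S} := fun _ _ hab ha => hS (add_le_add_right hab e) ha

variable [DecidableEq V]

lemma MonoVanish.univ (ρ : V → ℕ) (i : ℕ) : MonoVanish K ρ i (Set.univ : Set (V →₀ ℕ)) := by
  intro hS
  have : restrictSupportIdeal K Set.univ hS = (⊤ : Ideal (MvPolynomial V K)) :=
    eq_top_iff.2 fun f _ => mem_monoIdeal.2 fun _ _ => trivial
  rw [this]
  exact IdealVanish.top _ _ _

lemma MonoVanish.of_colon_of_sup {ρ : V → ℕ} (hρ : Function.Injective ρ) {i : ℕ}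
    {S : Set (V →₀ ℕ)} (e : V →₀ ℕ) (h₁ : MonoVanish K ρ i {m | e + m ∈ S})
    (h₂ : MonoVanish K ρ i (S ∪ Set.Ici e)) : MonoVanish K ρ i S := by
  intro hS
  have hS' := isUpperSet_colon hS e
  have hS₂ := hS.union (isUpperSet_Ici e)
  refine IdealVanish.of_colon_of_sup hρ (monomial_mul_mem_monoIdeal e hS') ?_
    (fun g hg => exists_sub_monomial_mul_mem e hg) (h₁ hS') (h₂ hS₂)
  intro f hf
  exact mem_monoIdeal.2 fun m hm => Or.inl (mem_monoIdeal.1 hf m hm)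

lemma MonoVanish.of_regular {ρ : V → ℕ} (hρ : Function.Injective ρ) {i : ℕ}
    {S : Set (V →₀ ℕ)} (w : V) (h₁ : ∀ m, Finsupp.single w 1 + m ∈ S → m ∈ S)
    (h₂ : ∀ j, j + 1 = i → MonoVanish K ρ j (S ∪ Set.Ici (Finsupp.single w 1))) :
    MonoVanish K ρ i S := by
  intro hS
  have hS' := isUpperSet_colon hS (Finsupp.single w 1)
  have hS₂ := hS.union (isUpperSet_Ici (Finsupp.single w 1))
  refine IdealVanish.of_regular hρ (y := w) (I₂ := restrictSupportIdeal K _ hS₂)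
    (fun g hg => ?_) ?_ ?_
    (fun g hg => exists_sub_monomial_mul_mem _ hg) (fun j hj => h₂ j hj hS₂)
  · have := (monomial_mul_mem_monoIdeal _ hS' g).1 hg
    exact mem_monoIdeal.2 fun m hm => h₁ m (mem_monoIdeal.1 this m hm)
  · intro f hf
    exact mem_monoIdeal.2 fun m hm => Or.inl (mem_monoIdeal.1 hf m hm)
  · exact monomial_mem_monoIdeal _ (Or.inr Set.self_mem_Ici)

/-- Exponents of the monomials in the ideal generated by the variables in `T`. -/
def varSet (T : Finset V) : Set (V →₀ ℕ) := {m | ∃ u ∈ T, m u ≠ 0}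

lemma varSet_union_Ici_single (T : Finset V) (w : V) :
    varSet T ∪ Set.Ici (Finsupp.single w 1) = varSet (insert w T) := by
  ext m
  simp [varSet, Finsupp.single_le_iff, Nat.one_le_iff_ne_zero, or_comm]

omit [DecidableEq V] in
lemma add_mem_varSet {T : Finset V} {e m : V →₀ ℕ} (he : ∀ u ∈ T, e u = 0) :
    e + m ∈ varSet T ↔ m ∈ varSet T := by
  simp only [varSet, Set.mem_ofPred_eq, Finsupp.add_apply]
  refine exists_congr fun u => and_congr_right fun hu => ?_
  rw [he u hu, zero_add]

variable [Fintype V]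

lemma monoVanish_varSet {ρ : V → ℕ} (hρ : Function.Injective ρ) {i : ℕ} {T : Finset V}
    (h : i + T.card < Fintype.card V) : MonoVanish K ρ i (varSet T) := by
  induction i generalizing T with
  | zero =>
    obtain ⟨w, hw⟩ : ∃ w, w ∉ T := by
      by_contra! hT
      rw [Finset.eq_univ_of_forall hT, Finset.card_univ] at h
      omega
    refine MonoVanish.of_regular hρ w (fun m hm => (add_mem_varSet ?_).1 hm)
      (fun j hj => by omega)
    intro u hu
    exact Finsupp.single_eq_of_ne (fun h => hw (h ▸ hu))
  | succ i ih =>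
    obtain ⟨w, hw⟩ : ∃ w, w ∉ T := by
      by_contra! hT
      rw [Finset.eq_univ_of_forall hT, Finset.card_univ] at h
      omega
    refine MonoVanish.of_regular hρ w (fun m hm => (add_mem_varSet ?_).1 hm)
      (fun j hj => ?_)
    · intro u hu
      exact Finsupp.single_eq_of_ne (fun h => hw (h ▸ hu))
    · obtain rfl : j = i := by omega
      rw [varSet_union_Ici_single]
      apply ih
      rw [Finset.card_insert_of_notMem hw]
      omega

lemma monoVanish_varSet_union_Ici {ρ : V → ℕ} (hρ : Function.Injective ρ) {i : ℕ}
    {T : Finset V} (h : i + T.card + 1 < Fintype.card V) (e : V →₀ ℕ) (he : ∀ u ∈ T, e u = 0) :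
    MonoVanish K ρ i (varSet T ∪ Set.Ici e) := by
  induction hn : e.degree generalizing e with
  | zero =>
    have : varSet T ∪ Set.Ici e = Set.univ := by
      rw [Finsupp.degree_eq_zero_iff] at hn
      subst hn
      ext m
      simp
    rw [this]
    exact MonoVanish.univ ρ i
  | succ n ih =>
    obtain ⟨w, hw⟩ : ∃ w, e w ≠ 0 := by
      by_contra! h0
      have : e = 0 := Finsupp.ext h0
      simp [this] at hn
    obtain ⟨e', rfl⟩ : ∃ e', e = e' + Finsupp.single w 1 :=
      ⟨e - Finsupp.single w 1, (tsub_add_cancel_of_le (by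
        rw [Finsupp.single_le_iff]; omega)).symm⟩
    have hwT : w ∉ T := fun hT => hw (he w hT)
    have he' : ∀ u ∈ T, e' u = 0 := fun u hu => by
      have := he u hu
      simp only [Finsupp.add_apply] at this
      omega
    refine MonoVanish.of_colon_of_sup hρ e' ?_ ?_
    · have : {m | e' + m ∈ varSet T ∪ Set.Ici (e' + Finsupp.single w 1)}
          = varSet (insert w T) := by
        rw [← varSet_union_Ici_single]
        ext m
        simp [add_mem_varSet he']
      rw [this]
      apply monoVanish_varSet hρ
      rw [Finset.card_insert_of_notMem hwT]
      omega
    · have : varSet T ∪ Set.Ici (e' + Finsupp.single w 1) ∪ Set.Ici e'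
          = varSet T ∪ Set.Ici e' := by
        have hle : e' ≤ e' + Finsupp.single w 1 := le_self_add
        rw [Set.union_assoc, Set.union_eq_self_of_subset_left (Set.Ici_subset_Ici.2 hle)]
      rw [this]
      apply ih e' he'
      simpa [map_add] using hn

end Monomial

end DS

namespace DS

/-! ### Vanishing below the expected depth -/

section CoverSet

variable {V : Type*}

/-- The exponents `m` with `m x + m y ≥ h x + h y` for all edges `{x, y}`. -/
def coverSet (G : SimpleGraph V) (h : V → ℤ) : Set (V →₀ ℕ) :=
  {m | ∀ x y, G.Adj x y → h x + h y ≤ m x + m y}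

lemma isUpperSet_coverSet (G : SimpleGraph V) (h : V → ℤ) : IsUpperSet (coverSet G h) := by
  intro a b hab ha x y hxy
  have h1 := ha x y hxy
  have h2 := hab x
  have h3 := hab y
  omega

/-- The graph obtained from `G` by deleting all edges meeting the closed neighbourhood of `u`. -/
def awayFrom (G : SimpleGraph V) (u : V) : SimpleGraph V where
  Adj x y := G.Adj x y ∧ (x ≠ u ∧ ¬ G.Adj u x) ∧ (y ≠ u ∧ ¬ G.Adj u y)
  symm := ⟨fun _ _ h => ⟨h.1.symm, h.2.2, h.2.1⟩⟩
  loopless := ⟨fun _ h => h.1.ne rfl⟩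

lemma sumElim_injective_iff {α β : Type*} {f : α → V} {g : β → V} :
    Function.Injective (Sum.elim f g) ↔
      Function.Injective f ∧ Function.Injective g ∧ ∀ a b, f a ≠ g b :=
  ⟨fun h => ⟨h.comp Sum.inl_injective, h.comp Sum.inr_injective,
    fun a b hab => Sum.inl_ne_inr (@h (Sum.inl a) (Sum.inr b) hab)⟩,
    fun h => h.1.sumElim h.2.1 h.2.2⟩

/-- An ordered matching away from `u` extends by an edge at `u`. -/
lemma IsOrderedMatching.snoc {G : SimpleGraph V} {u₀ v₀ : V} (h₀ : G.Adj u₀ v₀) {s : ℕ}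
    {u v : Fin s → V} (h : IsOrderedMatching (awayFrom G u₀) u v) :
    IsOrderedMatching G (Fin.snoc u u₀ : Fin (s + 1) → V) (Fin.snoc v v₀ : Fin (s + 1) → V) := by
  obtain ⟨⟨hinj, hadj⟩, hind, hord⟩ := h
  have hu : ∀ i, u i ≠ u₀ ∧ ¬ G.Adj u₀ (u i) := fun i => (hadj i).2.1
  have hv : ∀ i, v i ≠ u₀ ∧ ¬ G.Adj u₀ (v i) := fun i => (hadj i).2.2
  have hu' : ∀ i, u i ≠ v₀ := fun i h => (hu i).2 (h ▸ h₀)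
  have hv' : ∀ i, v i ≠ v₀ := fun i h => (hv i).2 (h ▸ h₀)
  rw [sumElim_injective_iff] at hinj
  obtain ⟨hui, hvi, huv⟩ := hinj
  refine ⟨⟨?_, ?_⟩, ?_, ?_⟩
  · rw [sumElim_injective_iff]
    refine ⟨?_, ?_, ?_⟩
    · rw [Fin.snoc_injective_iff]
      exact ⟨hui, fun ⟨i, hi⟩ => (hu i).1 hi⟩
    · rw [Fin.snoc_injective_iff]
      exact ⟨hvi, fun ⟨i, hi⟩ => hv' i hi⟩
    · intro i j
      refine Fin.lastCases ?_ (fun i => ?_) i <;> refine Fin.lastCases ?_ (fun j => ?_) j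
      · simpa using h₀.ne
      · simpa using (hv j).1.symm
      · simpa using hu' i
      · simpa using huv i j
  · intro i
    refine Fin.lastCases ?_ (fun i => ?_) i
    · simpa using h₀
    · simpa using (hadj i).1
  · intro i j
    refine Fin.lastCases ?_ (fun i => ?_) i <;> refine Fin.lastCases ?_ (fun j => ?_) j
    · simp
    · simpa using (hu j).2
    · simpa using fun h => (hu i).2 h.symm
    · simpa using fun h => hind i j ⟨h, hu i, hu j⟩
  · intro i j
    refine Fin.lastCases ?_ (fun i => ?_) i <;> refine Fin.lastCases ?_ (fun j => ?_) j
    · simp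
    · simpa using fun h => absurd h (hv j).2
    · simpa using fun _ => (Fin.castSucc_lt_last i).le
    · simpa using fun h => hord i j ⟨h, hu i, hv j⟩

lemma isOrderedMatching_single {G : SimpleGraph V} {u v : V} (h : G.Adj u v) :
    IsOrderedMatching G (fun _ : Fin 1 => u) (fun _ => v) := by
  refine ⟨⟨?_, fun _ => h⟩, fun _ _ => G.irrefl, fun i j _ => (Subsingleton.elim i j).le⟩
  rw [sumElim_injective_iff]
  exact ⟨Function.injective_of_subsingleton _, Function.injective_of_subsingleton _,
    fun _ _ => h.ne⟩

variable [Fintype V] [DecidableEq V]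

open Classical in
/-- Koszul vanishing for the cover ideal type monomial ideals, below the bound given by the
ordered matchings. -/
theorem monoVanish_coverSet (K : Type*) [Field K] {ρ : V → ℕ} (hρ : Function.Injective ρ)
    (k : ℕ) (T : Finset V) (G : SimpleGraph V) (h : V → ℤ)
    (hT : ∀ u ∈ T, ∀ x, ¬ G.Adj u x)
    (hk : ∀ s (u v : Fin s → V), IsOrderedMatching G u v → s ≤ k) {i : ℕ}
    (hi : i + T.card + k + 1 < Fintype.card V) :
    MonoVanish K ρ i (varSet T ∪ coverSet G h) := by
  induction k using Nat.strong_induction_on generalizing T G h i with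
  | _ k ihk =>
  induction hμ : ∑ x, ∑ y, (if G.Adj x y then (h x + h y).toNat else 0)
    using Nat.strong_induction_on generalizing h with
  | _ μ ihμ =>
  by_cases hpos : ∃ u v, G.Adj u v ∧ 0 < h u + h v
  swap
  · push Not at hpos
    have : varSet T ∪ coverSet G h = Set.univ := by
      refine Set.eq_univ_of_forall fun m => Or.inr fun x y hxy => ?_
      have := hpos x y hxy
      omega
    rw [this]
    exact MonoVanish.univ ρ i
  obtain ⟨u, hu, hmax⟩ : ∃ u, (∃ v, G.Adj u v ∧ 0 < h u + h v) ∧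
      ∀ x y, G.Adj x y → 0 < h x + h y → h x ≤ h u := by
    obtain ⟨u, hu, hmax⟩ := Finset.exists_max_image
      (Finset.univ.filter fun u => ∃ v, G.Adj u v ∧ 0 < h u + h v) h
      (by obtain ⟨u, hu⟩ := hpos; exact ⟨u, by simpa using hu⟩)
    exact ⟨u, by simpa using hu, fun x y hxy hp => hmax x (by simpa using ⟨y, hxy, hp⟩)⟩
  obtain ⟨v, huv, hp⟩ := hu
  have huT : u ∉ T := fun h => hT u h v huv
  have hk1 : 1 ≤ k := hk 1 _ _ (isOrderedMatching_single huv)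
  refine MonoVanish.of_colon_of_sup hρ (Finsupp.single u 1) ?_ ?_
  · have hset : {m | Finsupp.single u 1 + m ∈ varSet T ∪ coverSet G h}
        = varSet T ∪ coverSet G (h - Pi.single u 1) := by
      ext m
      refine or_congr (add_mem_varSet fun t ht =>
        Finsupp.single_eq_of_ne fun h => huT (h ▸ ht)) ?_
      refine forall_congr' fun x => forall_congr' fun y => forall_congr' fun _ => ?_
      simp only [Finsupp.add_apply, Finsupp.single_apply, Pi.sub_apply, Pi.single_apply,
        eq_comm (a := u)]
      split_ifs <;> push_cast <;> constructor <;> intro <;> omega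
    rw [hset]
    refine ihμ _ ?_ _ rfl
    rw [← hμ]
    obtain ⟨h', hh'⟩ : ∃ h' : V → ℤ, h - Pi.single u 1 = h' := ⟨_, rfl⟩
    rw [hh']
    have hle : ∀ x, h' x ≤ h x := by
      intro x
      simp only [← hh', Pi.sub_apply, Pi.single_apply]
      split_ifs <;> omega
    have hle' : ∀ x y, (if G.Adj x y then (h' x + h' y).toNat else 0) ≤ if G.Adj x y then (h x + h y).toNat else 0 := by
      intro x y
      have hx := hle x
      have hy := hle y
      split_ifs
      · exact Int.toNat_le_toNat (add_le_add hx hy)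
      · exact le_rfl
    refine Finset.sum_lt_sum (fun x _ => Finset.sum_le_sum fun y _ => hle' x y)
      ⟨u, Finset.mem_univ _, Finset.sum_lt_sum (fun y _ => hle' u y)
        ⟨v, Finset.mem_univ _, ?_⟩⟩
    have hv := hle v
    have hu' : h' u = h u - 1 := by simp [← hh']
    rw [if_pos huv, if_pos huv, hu']
    omega
  · have hS : varSet T ∪ coverSet G h ∪ Set.Ici (Finsupp.single u 1)
        = varSet (insert u T) ∪ coverSet G h := by
      rw [Set.union_right_comm, varSet_union_Ici_single]
    rw [hS]
    have hT' : ∀ t ∈ insert u T, ¬ G.Adj u t := fun t ht hut => by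
      rcases Finset.mem_insert.1 ht with rfl | ht
      · exact hut.ne rfl
      · exact hT t ht u hut.symm
    obtain ⟨e, he⟩ : ∃ e : V →₀ ℕ, ∀ x, e x = if G.Adj u x then (h u + h x).toNat else 0 :=
      ⟨Finsupp.equivFunOnFinite.symm _, fun _ => rfl⟩
    have heT : ∀ t ∈ insert u T, e t = 0 := fun t ht => by rw [he, if_neg (hT' t ht)]
    refine MonoVanish.of_colon_of_sup hρ e ?_ ?_
    · have hset : {m | e + m ∈ varSet (insert u T) ∪ coverSet G h}
          = varSet (insert u T) ∪ coverSet (awayFrom G u) h := by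
        ext m
        simp only [Set.mem_ofPred_eq, Set.mem_union, add_mem_varSet heT]
        by_cases hm : m ∈ varSet (insert u T)
        · simp [hm]
        simp only [hm, false_or]
        constructor
        · intro H x y hxy
          have := H x y hxy.1
          simpa [he, hxy.2.1.2, hxy.2.2.2] using this
        · intro H
          have key : ∀ x y, G.Adj x y → (x = u ∨ G.Adj u y) →
              h x + h y ≤ (e + m) x + (e + m) y := by
            rintro x y hxy (rfl | hy)
            · have := he y
              rw [if_pos hxy] at this
              simp only [Finsupp.add_apply]
              push_cast
              omega
            · have := he y
              rw [if_pos hy] at this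
              simp only [Finsupp.add_apply]
              push_cast
              by_cases h0 : 0 < h x + h y
              · have := hmax x y hxy h0
                omega
              · omega
          intro x y hxy
          by_cases hx : x = u ∨ G.Adj u y
          · exact key x y hxy hx
          by_cases hy : y = u ∨ G.Adj u x
          · rw [add_comm, add_comm (((e + m) x : ℕ) : ℤ)]
            exact key y x hxy.symm hy
          push Not at hx hy
          have := H x y ⟨hxy, ⟨hx.1, hy.2⟩, hy.1, hx.2⟩
          simpa [he, hx.2, hy.2] using this
      rw [hset]
      refine ihk (k - 1) (by omega) (insert u T) (awayFrom G u) h ?_ ?_ ?_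
      · intro t ht x htx
        rcases Finset.mem_insert.1 ht with rfl | ht
        · exact htx.2.1.1 rfl
        · exact hT t ht x htx.1
      · intro s u' v' hs
        have := hk _ _ _ (hs.snoc huv)
        omega
      · rw [Finset.card_insert_of_notMem huT]
        omega
    · have hset : varSet (insert u T) ∪ coverSet G h ∪ Set.Ici e
          = varSet (insert u T) ∪ Set.Ici e := by
        refine Set.Subset.antisymm (Set.union_subset (Set.union_subset
          Set.subset_union_left ?_) Set.subset_union_right)
          (Set.union_subset_union_left _ Set.subset_union_left)
        intro m hm
        by_cases hmu : m u = 0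
        · refine Or.inr fun x => ?_
          rw [he]
          split_ifs with hux
          · have := hm u x hux
            omega
          · exact Nat.zero_le _
        · exact Or.inl ⟨u, Finset.mem_insert_self _ _, hmu⟩
      rw [hset]
      refine monoVanish_varSet_union_Ici hρ ?_ e heT
      rw [Finset.card_insert_of_notMem huT]
      omega

end CoverSet

end DS

namespace DS

/-! ### Powers of the cover ideal as monomial ideals -/

section Ideals

open MvPolynomial

variable {V : Type*} {K : Type*} [Field K]

lemma monoIdeal_le {S : Set (V →₀ ℕ)} {hS : IsUpperSet S} {I : Ideal (MvPolynomial V K)}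
    (h : ∀ m ∈ S, monomial m 1 ∈ I) : restrictSupportIdeal K S hS ≤ I := by
  intro f hf
  rw [f.as_sum]
  refine Ideal.sum_mem _ fun m hm => ?_
  have := I.mul_mem_left (C (f.coeff m)) (h m (mem_monoIdeal.1 hf m (mem_support_iff.1 hm)))
  rwa [C_mul_monomial, mul_one] at this

lemma mem_span_pair_pow {x y : V} (hxy : x ≠ y) {n : ℕ} {f : MvPolynomial V K} :
    f ∈ Ideal.span {(X x : MvPolynomial V K), X y} ^ n ↔
      ∀ m, f.coeff m ≠ 0 → n ≤ m x + m y := by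
  classical
  have hS : ∀ n, IsUpperSet {m : V →₀ ℕ | n ≤ m x + m y} :=
    fun n a b hab ha => le_trans ha (add_le_add (hab x) (hab y))
  have key : Ideal.span {(X x : MvPolynomial V K), X y} ^ n
      = restrictSupportIdeal K {m : V →₀ ℕ | n ≤ m x + m y} (hS n) := by
    apply le_antisymm
    · induction n with
      | zero => exact fun f _ => mem_monoIdeal.2 fun m _ => Nat.zero_le _
      | succ n ih =>
        rw [pow_succ', Ideal.mul_le]
        intro r hr s hs
        obtain ⟨a, b, rfl⟩ := Ideal.mem_span_pair.1 hr
        have hX : ∀ w, (w = x ∨ w = y) → X w * s ∈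
            restrictSupportIdeal K {m : V →₀ ℕ | n + 1 ≤ m x + m y} (hS (n + 1)) := by
          intro w hw
          refine (monomial_mul_mem_monoIdeal (Finsupp.single w 1)
            (isUpperSet_colon (hS (n + 1)) _) s).2 ?_
          refine mem_monoIdeal.2 fun m hm => ?_
          have := mem_monoIdeal.1 (ih hs) m hm
          simp only [Set.mem_ofPred_eq, Finsupp.add_apply] at this ⊢
          rcases hw with rfl | rfl <;> simp only [Finsupp.single_eq_same] <;> omega
        rw [add_mul, mul_assoc, mul_assoc]
        exact Ideal.add_mem _ (Ideal.mul_mem_left _ _ (hX x (Or.inl rfl)))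
          (Ideal.mul_mem_left _ _ (hX y (Or.inr rfl)))
    · refine monoIdeal_le ?_
      induction n with
      | zero => simp
      | succ n ih =>
        intro m hm
        obtain ⟨w, hw, m', rfl, hs⟩ : ∃ w, (w = x ∨ w = y) ∧ ∃ m' : V →₀ ℕ,
            m = Finsupp.single w 1 + m' ∧ n ≤ m' x + m' y := by
          have hdec : ∀ w, m w ≠ 0 → ∃ m', m = Finsupp.single w 1 + m' := fun w hw =>
            ⟨m - Finsupp.single w 1, (add_tsub_cancel_of_le
              (Finsupp.single_le_iff.2 (Nat.one_le_iff_ne_zero.2 hw))).symm⟩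
          simp only [Set.mem_ofPred_eq] at hm
          by_cases hx : m x = 0
          · obtain ⟨m', rfl⟩ := hdec y (by omega)
            refine ⟨y, Or.inr rfl, m', rfl, ?_⟩
            simp only [Finsupp.add_apply, Finsupp.single_apply, if_true, if_neg hxy.symm] at hm
            omega
          · obtain ⟨m', rfl⟩ := hdec x hx
            refine ⟨x, Or.inl rfl, m', rfl, ?_⟩
            simp only [Finsupp.add_apply, Finsupp.single_apply, if_true, if_neg hxy] at hm
            omega
        have : (monomial (Finsupp.single w 1 + m') (1 : K)) = X w * monomial m' 1 := by
          rw [X, monomial_mul, one_mul]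
        rw [this, pow_succ']
        refine Ideal.mul_mem_mul (Ideal.subset_span ?_) (ih _ hs)
        rcases hw with rfl | rfl <;> simp
  rw [key, mem_monoIdeal]
  rfl

lemma mem_symbPow {G : SimpleGraph V} {n : ℕ} {f : MvPolynomial V K} :
    f ∈ symbPow K G n ↔ ∀ m, f.coeff m ≠ 0 → ∀ x y, G.Adj x y → n ≤ m x + m y := by
  simp only [symbPow, Ideal.mem_iInf, Prod.forall]
  constructor
  · intro h m hm x y hxy
    exact (mem_span_pair_pow hxy.ne).1 (h x y hxy) m hm
  · intro h x y hxy
    exact (mem_span_pair_pow hxy.ne).2 fun m hm => h m hm x y hxy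

lemma monomial_mem_symbPow {G : SimpleGraph V} {n : ℕ} {m : V →₀ ℕ}
    (h : ∀ x y, G.Adj x y → n ≤ m x + m y) (a : K) : monomial m a ∈ symbPow K G n := by
  classical
  rw [mem_symbPow]
  intro k hk
  rw [coeff_monomial] at hk
  split_ifs at hk with hmk
  · exact hmk ▸ h
  · exact absurd rfl hk

lemma symbPow_eq_monoIdeal {G : SimpleGraph V} {n : ℕ} {h : V → ℤ}
    (hn : ∀ x y, G.Adj x y → h x + h y = n) :
    symbPow K G n = restrictSupportIdeal K (coverSet G h) (isUpperSet_coverSet G h) := by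
  ext f
  rw [mem_symbPow, mem_monoIdeal]
  refine forall₂_congr fun m _ => forall₂_congr fun x y => forall_congr' fun hxy => ?_
  rw [hn x y hxy]
  norm_cast

/-- For bipartite graphs the ordinary powers of the cover ideal are the symbolic powers. -/
theorem coverIdeal_pow_eq_symbPow [Finite V] {G : SimpleGraph V} {c : V → Bool}
    (hc : ∀ ⦃x y⦄, G.Adj x y → c x ≠ c y) (n : ℕ) : coverIdeal K G ^ n = symbPow K G n := by
  apply le_antisymm
  · refine le_iInf₂ fun p hp => Ideal.pow_right_mono ?_ n
    refine (iInf₂_le (f := fun (p : V × V) (_ : G.Adj p.1 p.2) =>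
      Ideal.span {(X p.1 : MvPolynomial V K), X p.2} ^ 1) p hp).trans ?_
    rw [pow_one]
  · intro f hf
    rw [f.as_sum]
    refine Ideal.sum_mem _ fun m hm => ?_
    have hm' := mem_symbPow.1 hf m (mem_support_iff.1 hm)
    generalize f.coeff m = a
    clear hf hm f
    induction n generalizing m a with
    | zero => simp
    | succ n ih =>
      obtain ⟨e, he⟩ : ∃ e : V →₀ ℕ, ∀ x, e x =
          if c x = true then (if 1 ≤ m x then 1 else 0) else if n + 1 ≤ m x then 1 else 0 :=
        ⟨Finsupp.equivFunOnFinite.symm _, fun _ => rfl⟩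
      obtain ⟨m', rfl⟩ : ∃ m', m = e + m' := by
        refine ⟨m - e, (add_tsub_cancel_of_le fun x => ?_).symm⟩
        rw [he]
        split_ifs <;> omega
      have hcov : ∀ x y, G.Adj x y → c x = true → 1 ≤ e x + e y ∧ n ≤ m' x + m' y := by
        intro x y hxy hx
        have hy : c y ≠ true := fun hy => hc hxy (hx.trans hy.symm)
        have h1 := hm' x y hxy
        have hex := he x
        have hey := he y
        rw [if_pos hx] at hex
        rw [if_neg hy] at hey
        have hx' := Finsupp.add_apply e m' x
        have hy' := Finsupp.add_apply e m' y
        split_ifs at hex hey <;> omega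
      have hcov' : ∀ x y, G.Adj x y → 1 ≤ e x + e y ∧ n ≤ m' x + m' y := by
        intro x y hxy
        by_cases hx : c x = true
        · exact hcov x y hxy hx
        · have hy : c y = true := by
            have := hc hxy
            revert hx this
            cases c x <;> cases c y <;> simp
          have := hcov y x hxy.symm hy
          omega
      have : monomial (e + m') a = monomial e (1 : K) * monomial m' a := by
        rw [monomial_mul, one_mul]
      rw [this, pow_succ']
      exact Ideal.mul_mem_mul (monomial_mem_symbPow (fun x y h => (hcov' x y h).1) _)
        (ih m' (fun x y h => (hcov' x y h).2) a)

/-! ### Consequences for regular sequences -/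

lemma top_ne_smul_quotient {R : Type*} [CommRing R] {I J : Ideal R} (h : J ⊔ I ≠ ⊤) :
    (⊤ : Submodule R (R ⧸ I)) ≠ J • ⊤ := by
  intro htop
  apply h
  have h1 : (J • ⊤ : Submodule R (R ⧸ I)) = Submodule.map I.mkQ J := by
    rw [← I.range_mkQ, ← Submodule.map_top, ← Submodule.map_smul'']
    simp
  have h2 := Submodule.comap_map_mkQ I J
  rw [← h1, ← htop, Submodule.comap_top] at h2
  rw [sup_comm]
  exact h2.symm

lemma span_range_X_ne_top :
    Ideal.span (Set.range (X : V → MvPolynomial V K)) ≠ ⊤ := by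
  intro h
  have h1 : Ideal.span (Set.range (X : V → MvPolynomial V K)) ≤
      RingHom.ker (constantCoeff : MvPolynomial V K →+* K) := by
    rw [Ideal.span_le]
    rintro _ ⟨x, rfl⟩
    simp
  rw [h] at h1
  have : (1 : MvPolynomial V K) ∈ RingHom.ker (constantCoeff : MvPolynomial V K →+* K) :=
    h1 Submodule.mem_top
  simp at this

lemma symbPow_le_span_range_X {G : SimpleGraph V} {x y : V} (hxy : G.Adj x y) {n : ℕ}
    (hn : 1 ≤ n) :
    symbPow K G n ≤ Ideal.span (Set.range (X : V → MvPolynomial V K)) := by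
  refine (iInf₂_le (f := fun (p : V × V) (_ : G.Adj p.1 p.2) =>
    Ideal.span {(X p.1 : MvPolynomial V K), X p.2} ^ n) (x, y) hxy).trans ?_
  refine (Ideal.pow_le_self (by omega)).trans (Ideal.span_mono ?_)
  rintro _ (rfl | rfl) <;> exact ⟨_, rfl⟩

/-- A regular sequence of the expected length on the quotient by a symbolic power. -/
theorem exists_isRegular_symbPow [Fintype V] {G : SimpleGraph V} {c : V → Bool}
    (hc : ∀ ⦃x y⦄, G.Adj x y → c x ≠ c y) {x₀ y₀ : V} (h₀ : G.Adj x₀ y₀) {n k : ℕ} (hn : 1 ≤ n)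
    (hk : ∀ s (u v : Fin s → V), IsOrderedMatching G u v → s ≤ k) :
    ∃ rs : List (MvPolynomial V K), rs.length = Fintype.card V - k - 1 ∧
      (∀ f ∈ rs, f ∈ Ideal.span (Set.range (X : V → MvPolynomial V K))) ∧
      RingTheory.Sequence.IsRegular (MvPolynomial V K ⧸ symbPow K G n) rs := by
  classical
  obtain ⟨ρ, hρ⟩ : ∃ ρ : V → ℕ, Function.Injective ρ :=
    ⟨fun x => (Fintype.equivFin V x : ℕ), Fin.val_injective.comp (Fintype.equivFin V).injective⟩
  obtain ⟨rs, hlen, hrs, hreg⟩ := exists_isWeaklyRegular_of_koszulVanish hρ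
    (z := (X : V → MvPolynomial V K)) (Fintype.card V - k - 1)
    (M := MvPolynomial V K ⧸ symbPow K G n) fun i hi => by
      apply IdealVanish.koszulVanish
      have hh : ∀ x y, G.Adj x y →
          (if c x then (n : ℤ) else 0) + (if c y then (n : ℤ) else 0) = n := by
        intro x y hxy
        have := hc hxy
        revert this
        cases c x <;> cases c y <;> simp
      rw [symbPow_eq_monoIdeal hh]
      have := monoVanish_coverSet K hρ k ∅ G (fun x => if c x then (n : ℤ) else 0)
        (by simp) hk (i := i) (by simp; omega)
      have he : varSet ∅ ∪ coverSet G (fun x => if c x then (n : ℤ) else 0)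
          = coverSet G (fun x => if c x then (n : ℤ) else 0) := by
        simp [varSet]
      rw [he] at this
      exact this _
  refine ⟨rs, hlen, hrs, hreg, ?_⟩
  apply top_ne_smul_quotient
  refine fun h => span_range_X_ne_top (V := V) (K := K) (top_le_iff.1 (h.symm.le.trans ?_))
  exact sup_le (Ideal.span_le.2 hrs) (symbPow_le_span_range_X h₀ hn)

end Ideals
end DS

namespace DS

/-! ### Alternating walks of an ordered matching -/

section Walks

variable {V : Type*} {G : SimpleGraph V} {s : ℕ} {u v : Fin s → V}

lemma mk_mem_omEdges {a b : V} :
    s(a, b) ∈ omEdges u v ↔ ∃ i, (a = u i ∧ b = v i) ∨ (a = v i ∧ b = u i) := by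
  simp only [omEdges, Set.mem_ofPred_eq, Sym2.eq_iff]

lemma isAlt_iff {M : Set (Sym2 V)} {a b : V} {w : G.Walk a b} :
    IsAlt M w ↔ w.edges.IsChain (fun e f => (e ∈ M ↔ f ∉ M)) := Iff.rfl

lemma IsOrderedMatching.injective_u (h : IsOrderedMatching G u v) : Function.Injective u :=
  (sumElim_injective_iff.1 h.1.1).1

lemma IsOrderedMatching.injective_v (h : IsOrderedMatching G u v) : Function.Injective v :=
  (sumElim_injective_iff.1 h.1.1).2.1

lemma IsOrderedMatching.u_ne_v (h : IsOrderedMatching G u v) (i j : Fin s) : u i ≠ v j :=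
  (sumElim_injective_iff.1 h.1.1).2.2 i j

lemma IsOrderedMatching.mem_omEdges_u_v (h : IsOrderedMatching G u v) {i j : Fin s} :
    s(u i, v j) ∈ omEdges u v ↔ i = j := by
  rw [mk_mem_omEdges]
  constructor
  · rintro ⟨k, ⟨h1, h2⟩ | ⟨h1, h2⟩⟩
    · rw [h.injective_u h1, h.injective_v h2]
    · exact absurd h1 (h.u_ne_v i k)
  · rintro rfl
    exact ⟨i, Or.inl ⟨rfl, rfl⟩⟩

lemma IsOrderedMatching.v_v_notMem (h : IsOrderedMatching G u v) (i j : Fin s) :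
    s(v i, v j) ∉ omEdges u v := by
  rw [mk_mem_omEdges]
  rintro ⟨k, ⟨h1, h2⟩ | ⟨h1, h2⟩⟩
  · exact h.u_ne_v k i h1.symm
  · exact h.u_ne_v k j h2.symm

/-- A potential increasing along alternating walks bounds their length. -/
lemma IsOrderedMatching.length_le (h : IsOrderedMatching G u v) {φ : V → ℕ}
    (hu : ∀ i, φ (u i) + i + 1 = s) (hv : ∀ i, φ (v i) = s + i) {a b : V} (w : G.Walk a b)
    (hw : w.edges.IsChain (fun e f => (e ∈ omEdges u v ↔ f ∉ omEdges u v)))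
    (hM : ∀ e ∈ w.edges.head?, e ∈ omEdges u v) (h0 : w.length ≠ 0) :
    w.length + 2 * φ a ≤ 4 * s := by
  induction hN : w.length using Nat.strong_induction_on generalizing a b with
  | _ N ih =>
  match w with
  | .nil => exact absurd rfl h0
  | .cons (v := x) hax w₁ =>
    have hax' : s(a, x) ∈ omEdges u v := hM _ (by simp)
    rw [mk_mem_omEdges] at hax'
    match w₁ with
    | .nil =>
      simp only [SimpleGraph.Walk.length_cons, SimpleGraph.Walk.length_nil] at hN
      obtain ⟨i, ⟨rfl, rfl⟩ | ⟨rfl, rfl⟩⟩ := hax'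
      · have := hu i
        omega
      · have := hv i
        omega
    | .cons (v := y) hxy w₂ =>
      rw [SimpleGraph.Walk.edges_cons, SimpleGraph.Walk.edges_cons, List.isChain_cons_cons] at hw
      obtain ⟨hw1, hw2⟩ := hw
      have hxy' : s(x, y) ∉ omEdges u v := hw1.1 (hM _ (by simp))
      simp only [SimpleGraph.Walk.length_cons] at hN
      by_cases h2 : w₂.length = 0
      · obtain ⟨i, ⟨rfl, rfl⟩ | ⟨rfl, rfl⟩⟩ := hax'
        · have := hu i
          omega
        · have := hv i
          omega
      · have hM2 : ∀ e ∈ w₂.edges.head?, e ∈ omEdges u v := by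
          intro e he
          by_contra hcon
          exact hxy' ((List.isChain_cons.1 hw2).1 e he |>.2 hcon)
        have key := ih w₂.length (by omega) w₂ (List.isChain_cons.1 hw2).2 hM2 h2 rfl
        have hy : ∃ j, y = u j ∨ y = v j := by
          match w₂ with
          | .nil => exact absurd rfl h2
          | .cons (v := t) hyt _ =>
            have hyt' : s(y, t) ∈ omEdges u v := hM2 _ (by simp)
            obtain ⟨j, ⟨h1, -⟩ | ⟨h1, -⟩⟩ := mk_mem_omEdges.1 hyt'
            · exact ⟨j, Or.inl h1⟩
            · exact ⟨j, Or.inr h1⟩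
        obtain ⟨i, ⟨rfl, rfl⟩ | ⟨rfl, rfl⟩⟩ := hax' <;> obtain ⟨j, rfl | rfl⟩ := hy
        · have hji := h.2.2 j i hxy.symm
          have hne : j ≠ i := fun hji => hxy' (by
            rw [Sym2.eq_swap]
            exact h.mem_omEdges_u_v.2 hji)
          have := lt_of_le_of_ne hji hne
          rw [Fin.lt_def] at this
          have := hu i
          have := hu j
          omega
        · have := hu i
          have := hv j
          omega
        · exact absurd hxy (h.2.1 i j)
        · have hij := h.2.2 i j hxy
          have hne : i ≠ j := fun hij => hxy' (h.mem_omEdges_u_v.2 hij)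
          have := lt_of_le_of_ne hij hne
          rw [Fin.lt_def] at this
          have := hv i
          have := hv j
          omega

lemma IsOrderedMatching.bddAbove (h : IsOrderedMatching G u v) :
    BddAbove {n | ∃ (a b : V) (w : G.Walk a b), IsAlt (omEdges u v) w ∧ w.length = n} := by
  obtain ⟨φ, hu, hv⟩ : ∃ φ : V → ℕ, (∀ i, φ (u i) + i + 1 = s) ∧ ∀ i, φ (v i) = s + i := by
    refine ⟨Function.extend (Sum.elim u v)
      (Sum.elim (fun i => s - 1 - (i : ℕ)) fun i => s + i) 0, fun i => ?_, fun i => ?_⟩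
    · have := h.1.1.extend_apply (Sum.elim (fun i => s - 1 - (i : ℕ)) fun i => s + i) 0 (Sum.inl i)
      simp only [Sum.elim_inl] at this
      rw [this]
      omega
    · exact h.1.1.extend_apply (Sum.elim (fun i => s - 1 - (i : ℕ)) fun i => s + i) 0 (Sum.inr i)
  refine ⟨4 * s + 1, ?_⟩
  rintro _ ⟨a, b, w, hw, rfl⟩
  rw [isAlt_iff] at hw
  by_cases hM : ∀ e ∈ w.edges.head?, e ∈ omEdges u v
  · by_cases h0 : w.length = 0
    · omega
    · have := h.length_le hu hv w hw hM h0
      omega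
  · match w with
    | .nil => simp
    | .cons hax w₁ =>
      rw [SimpleGraph.Walk.edges_cons, List.isChain_cons] at hw
      simp only [SimpleGraph.Walk.edges_cons, List.head?_cons, Option.mem_def,
        Option.some.injEq, forall_eq'] at hM
      have hM1 : ∀ e ∈ w₁.edges.head?, e ∈ omEdges u v := fun e he => by
        by_contra hcon
        exact hM ((hw.1 e he).2 hcon)
      rw [SimpleGraph.Walk.length_cons]
      by_cases h0 : w₁.length = 0
      · omega
      · have := h.length_le hu hv w₁ hw.2 hM1 h0
        omega

/-- The vertex `v i` starts an alternating walk of length `2 k + 1` through the edge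
`{u i, v i}`. -/
def HasAltFrom (G : SimpleGraph V) {s : ℕ} (u v : Fin s → V) (i : Fin s) (k : ℕ) : Prop :=
  ∃ (b : V) (w : G.Walk (u i) b), w.length = 2 * k ∧
    (s(v i, u i) :: w.edges).IsChain (fun e f => (e ∈ omEdges u v ↔ f ∉ omEdges u v))

lemma IsOrderedMatching.mem_omEdges_v_u (h : IsOrderedMatching G u v) (i : Fin s) :
    s(v i, u i) ∈ omEdges u v := by
  rw [Sym2.eq_swap]
  exact h.mem_omEdges_u_v.2 rfl

lemma hasAltFrom_zero (i : Fin s) : HasAltFrom G u v i 0 :=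
  ⟨u i, .nil, rfl, by simp⟩

lemma HasAltFrom.succ (h : IsOrderedMatching G u v) {i j : Fin s} (hij : i ≠ j)
    (hadj : G.Adj (u i) (v j)) {k : ℕ} (hk : HasAltFrom G u v j k) :
    HasAltFrom G u v i (k + 1) := by
  obtain ⟨b, w, hlen, hw⟩ := hk
  refine ⟨b, .cons hadj (.cons (h.1.2 j).symm w), ?_, ?_⟩
  · simp only [SimpleGraph.Walk.length_cons, hlen]
    ring
  · have h1 := h.mem_omEdges_v_u i
    have h2 : s(u i, v j) ∉ omEdges u v := fun h' => hij (h.mem_omEdges_u_v.1 h')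
    have h3 := h.mem_omEdges_v_u j
    simp only [SimpleGraph.Walk.edges_cons, List.isChain_cons_cons]
    exact ⟨by simp [h1, h2], by simp [h2, h3], hw⟩

lemma HasAltFrom.le_ellM (h : IsOrderedMatching G u v) {i : Fin s} {k : ℕ}
    (hk : HasAltFrom G u v i k) : 2 * k + 1 ≤ ellM G (omEdges u v) := by
  obtain ⟨b, w, hlen, hw⟩ := hk
  exact le_csSup h.bddAbove ⟨v i, b, .cons (h.1.2 i).symm w, hw, by simp [hlen]⟩

lemma HasAltFrom.add_le_ellM (h : IsOrderedMatching G u v) {i j : Fin s} {k l : ℕ}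
    (hadj : G.Adj (v i) (v j)) (hk : HasAltFrom G u v i k) (hl : HasAltFrom G u v j l) :
    2 * (k + l) + 3 ≤ ellM G (omEdges u v) := by
  obtain ⟨b, w, hlen, hw⟩ := hk
  obtain ⟨b', w', hlen', hw'⟩ := hl
  refine le_csSup h.bddAbove ⟨b, b', (SimpleGraph.Walk.cons (h.1.2 i).symm w).reverse.append
    (.cons hadj (.cons (h.1.2 j).symm w')), ?_, ?_⟩
  · rw [isAlt_iff, SimpleGraph.Walk.edges_append, SimpleGraph.Walk.edges_reverse]
    simp only [SimpleGraph.Walk.edges_cons]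
    have h1 := h.mem_omEdges_v_u i
    have h2 := h.v_v_notMem i j
    have h3 := h.mem_omEdges_v_u j
    rw [List.isChain_append]
    refine ⟨?_, ?_, ?_⟩
    · rw [List.isChain_reverse]
      refine hw.imp fun e f hef => ?_
      tauto
    · rw [List.isChain_cons_cons]
      exact ⟨by simp [h2, h3], hw'⟩
    · simp [h1, h2]
  · simp only [SimpleGraph.Walk.length_append, SimpleGraph.Walk.length_reverse,
      SimpleGraph.Walk.length_cons, hlen, hlen']
    ring

/-- Lengths of alternating walks give levels compatible with the order of the matching. -/
lemma IsOrderedMatching.exists_level (h : IsOrderedMatching G u v) :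
    ∃ p : Fin s → ℕ, (∀ i j, i ≠ j → G.Adj (u i) (v j) → p j + 1 ≤ p i) ∧
      (∀ i, 2 * p i + 1 ≤ ellM G (omEdges u v)) ∧
      ∀ i j, G.Adj (v i) (v j) → 2 * (p i + p j) + 3 ≤ ellM G (omEdges u v) := by
  have hbdd : ∀ i, BddAbove {k | HasAltFrom G u v i k} := fun i =>
    ⟨ellM G (omEdges u v), fun k hk => by
      have := HasAltFrom.le_ellM h hk
      omega⟩
  have hmem : ∀ i, HasAltFrom G u v i (sSup {k | HasAltFrom G u v i k}) := fun i =>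
    Nat.sSup_mem ⟨0, hasAltFrom_zero i⟩ (hbdd i)
  exact ⟨fun i => sSup {k | HasAltFrom G u v i k},
    fun i j hij hadj => le_csSup (hbdd i) ((hmem j).succ h hij hadj),
    fun i => (hmem i).le_ellM h, fun i j hadj => (hmem i).add_le_ellM h hadj (hmem j)⟩

end Walks

end DS

namespace DS

/-! ### A nonzero Koszul class at the expected depth -/

section Level

open MvPolynomial

variable {V : Type*} [Fintype V] [DecidableEq V] {G : SimpleGraph V} {s : ℕ} {u v : Fin s → V}

/-- The vertices not covered by the matching. -/
def uncovered (u v : Fin s → V) : Finset V := Finset.univ.filter fun x => ∀ i, u i ≠ x ∧ v i ≠ x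

/-- The degree `a`, raised by one on the covered vertices in `F`. -/
noncomputable def levelDeg (u v : Fin s → V) (a : V → ℕ) (F : Finset V) : V →₀ ℕ :=
  Finsupp.equivFunOnFinite.symm fun x => a x + if x ∈ F ∧ x ∉ uncovered u v then 1 else 0

/-- `F` consists of the uncovered vertices and one end of every edge of the matching, except
for the edge with index `l`, none of whose ends lies in `F`. -/
def IsPartialTransversal (u v : Fin s → V) (l : Fin s) (F : Finset V) : Prop :=
  uncovered u v ⊆ F ∧ (u l ∉ F ∧ v l ∉ F) ∧ ∀ i, i ≠ l → (u i ∈ F ↔ v i ∉ F)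

lemma u_notMem_uncovered (i : Fin s) : u i ∉ uncovered u v := by
  simp only [uncovered, Finset.mem_filter, not_and, not_forall]
  exact fun _ => ⟨i, by simp⟩

lemma v_notMem_uncovered (i : Fin s) : v i ∉ uncovered u v := by
  simp only [uncovered, Finset.mem_filter, not_and, not_forall]
  exact fun _ => ⟨i, by simp⟩

lemma mem_uncovered_or (u v : Fin s → V) (x : V) :
    x ∈ uncovered u v ∨ (∃ i, x = u i) ∨ ∃ i, x = v i := by
  simp only [uncovered, Finset.mem_filter, Finset.mem_univ, true_and]
  by_contra! hcon
  obtain ⟨⟨i, hi⟩, hu, hv⟩ := hcon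
  exact hv i (hi (hu i).symm).symm

lemma levelDeg_apply (a : V → ℕ) (F : Finset V) (x : V) :
    levelDeg u v a F x = a x + if x ∈ F ∧ x ∉ uncovered u v then 1 else 0 := rfl

lemma levelDeg_erase (a : V → ℕ) {F : Finset V} {y : V} (hy : y ∈ F) (hyW : y ∉ uncovered u v) :
    levelDeg u v a F = Finsupp.single y 1 + levelDeg u v a (F.erase y) := by
  ext x
  simp only [Finsupp.add_apply, levelDeg_apply, Finset.mem_erase, Finsupp.single_apply]
  by_cases hxy : y = x
  · subst hxy
    simp [hy, hyW, add_comm]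
  · simp [hxy, Ne.symm hxy]

lemma sum_eq_uncovered_add (h : Function.Injective (Sum.elim u v)) (f : V → ℕ) :
    ∑ x, f x = ∑ x ∈ uncovered u v, f x + ∑ i, (f (u i) + f (v i)) := by
  rw [← Finset.sum_filter_add_sum_filter_not Finset.univ (fun x => ∀ i, u i ≠ x ∧ v i ≠ x) f]
  congr 1
  have : (Finset.univ.filter fun x => ¬ ∀ i, u i ≠ x ∧ v i ≠ x)
      = Finset.univ.image (Sum.elim u v) := by
    ext x
    simp only [Finset.mem_filter, Finset.mem_univ, true_and, Finset.mem_image, Sum.exists,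
      Sum.elim_inl, Sum.elim_inr, not_forall, not_and_or, not_not, exists_or]
  rw [this, Finset.sum_image fun x _ y _ hxy => h hxy, Fintype.sum_sum_type,
    Finset.sum_add_distrib]
  rfl

lemma IsPartialTransversal.card_add (h : Function.Injective (Sum.elim u v)) {l : Fin s}
    {F : Finset V} (hF : IsPartialTransversal u v l F) : F.card + s + 1 = Fintype.card V := by
  have h1 := sum_eq_uncovered_add h fun _ => 1
  have h2 := sum_eq_uncovered_add h fun x => if x ∈ F then 1 else 0
  have h3 : ∑ x ∈ uncovered u v, (if x ∈ F then 1 else 0) = (uncovered u v).card := by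
    rw [Finset.card_eq_sum_ones]
    exact Finset.sum_congr rfl fun x hx => if_pos (hF.1 hx)
  have h4 : ∑ i, ((if u i ∈ F then 1 else 0) + if v i ∈ F then 1 else 0)
      + 1 = s := by
    have : ∀ i, ((if u i ∈ F then 1 else 0) + if v i ∈ F then 1 else 0)
        + (if i = l then 1 else 0) = 1 := by
      intro i
      by_cases hi : i = l
      · subst hi
        simp [hF.2.1.1, hF.2.1.2]
      · have := hF.2.2 i hi
        by_cases hv : v i ∈ F <;> simp_all
    have hsum := Finset.sum_congr (rfl : (Finset.univ : Finset (Fin s)) = Finset.univ)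
      fun i _ => this i
    rw [Finset.sum_add_distrib] at hsum
    simpa using hsum
  simp only [Finset.sum_const, smul_eq_mul, Finset.card_univ, Finset.sum_ite_mem,
    Finset.univ_inter, Fintype.card_fin] at h1 h2 h3 h4
  omega

lemma exists_rank (h : Function.Injective (Sum.elim u v)) :
    ∃ ρ : V → ℕ, Function.Injective ρ ∧ ∀ i, ρ (v i) = ρ (u i) + 1 := by
  obtain ⟨ρ, hu, hv, hw⟩ : ∃ ρ : V → ℕ, (∀ i, ρ (u i) = 2 * i) ∧ (∀ i, ρ (v i) = 2 * i + 1) ∧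
      ∀ x ∈ uncovered u v, ρ x = 2 * s + Fintype.equivFin V x := by
    refine ⟨Function.extend (Sum.elim u v) (Sum.elim (fun i => 2 * (i : ℕ)) fun i => 2 * i + 1)
      fun x => 2 * s + Fintype.equivFin V x, fun i => ?_, fun i => ?_, fun x hx => ?_⟩
    · exact h.extend_apply _ _ (Sum.inl i)
    · exact h.extend_apply _ _ (Sum.inr i)
    · refine Function.extend_apply' _ _ _ ?_
      rintro ⟨i | i, rfl⟩
      · exact u_notMem_uncovered i hx
      · exact v_notMem_uncovered i hx
  refine ⟨ρ, fun x y hxy => ?_, fun i => by rw [hu, hv]⟩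
  rcases mem_uncovered_or u v x with hx | ⟨i, rfl⟩ | ⟨i, rfl⟩ <;>
    rcases mem_uncovered_or u v y with hy | ⟨j, rfl⟩ | ⟨j, rfl⟩
  · rw [hw x hx, hw y hy] at hxy
    exact (Fintype.equivFin V).injective (Fin.ext (by omega))
  · rw [hw x hx, hu] at hxy
    omega
  · rw [hw x hx, hv] at hxy
    omega
  · rw [hu, hw y hy] at hxy
    omega
  · rw [hu, hu] at hxy
    rw [Fin.ext (show (i : ℕ) = j by omega)]
  · rw [hu, hv] at hxy
    omega
  · rw [hv, hw y hy] at hxy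
    omega
  · rw [hu, hv] at hxy
    omega
  · rw [hv, hv] at hxy
    rw [Fin.ext (show (i : ℕ) = j by omega)]

omit [Fintype V] in
lemma koszulSign_succ (R : Type*) [CommRing R] {ρ : V → ℕ} (hρ : Function.Injective ρ) {x y : V}
    (hxy : ρ y = ρ x + 1) {F : Finset V} (hx : x ∈ F) :
    koszulSign R ρ y F = -koszulSign R ρ x F := by
  have : (F.filter fun k => ρ k < ρ y) = insert x (F.filter fun k => ρ k < ρ x) := by
    ext k
    simp only [Finset.mem_filter, Finset.mem_insert, hxy]
    constructor
    · rintro ⟨h1, h2⟩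
      by_cases hk : ρ k = ρ x
      · exact Or.inl (hρ hk)
      · exact Or.inr ⟨h1, by omega⟩
    · rintro (rfl | ⟨h1, h2⟩)
      · exact ⟨hx, by omega⟩
      · exact ⟨h1, by omega⟩
  rw [koszulSign, koszulSign, this, Finset.card_insert_of_notMem (by simp), pow_succ]
  ring

/-- The parameters used to detect the class: variables at the covered vertices and high powers
of the variables elsewhere. -/
noncomputable def levelParam (K : Type*) [Field K] (u v : Fin s → V) (n : ℕ) (x : V) :
    MvPolynomial V K :=
  if x ∈ uncovered u v then X x ^ (n + 1) else X x

open Classical in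
/-- The cochain representing the class. -/
noncomputable def levelCochain (K : Type*) [Field K] (u v : Fin s → V) (a : V → ℕ) (l : Fin s)
    (F : Finset V) : MvPolynomial V K :=
  if IsPartialTransversal u v l F then monomial (levelDeg u v a F) 1 else 0

variable {K : Type*} [Field K]

lemma levelParam_mul_monomial (a : V → ℕ) (n : ℕ) {F : Finset V} {y : V} (hy : y ∈ F)
    (hyW : y ∉ uncovered u v) :
    levelParam K u v n y * monomial (levelDeg u v a (F.erase y)) 1
      = monomial (levelDeg u v a F) 1 := by
  rw [levelParam, if_neg hyW, X, monomial_mul, one_mul, levelDeg_erase a hy hyW]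

lemma coeff_levelParam_mul (a : V → ℕ) (n : ℕ) {F : Finset V} {y : V} (hy : y ∈ F)
    (hyW : y ∉ uncovered u v) (g : MvPolynomial V K) :
    coeff (levelDeg u v a F) (levelParam K u v n y * g)
      = coeff (levelDeg u v a (F.erase y)) g := by
  rw [levelParam, if_neg hyW, levelDeg_erase a hy hyW, X, coeff_monomial_mul, one_mul]

lemma coeff_levelParam_mul_of_mem (a : V → ℕ) {n : ℕ} {y : V} (hyW : y ∈ uncovered u v)
    (hay : a y ≤ n) (F : Finset V) (g : MvPolynomial V K) :
    coeff (levelDeg u v a F) (levelParam K u v n y * g) = 0 := by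
  rw [levelParam, if_pos hyW, X_pow_eq_monomial, coeff_monomial_mul', if_neg]
  rw [Finsupp.single_le_iff, levelDeg_apply]
  simp only [hyW, not_true_eq_false, and_false, if_false]
  omega

lemma mem_radical_span_levelParam (n : ℕ) {f : MvPolynomial V K}
    (hf : f ∈ Ideal.span (Set.range (X : V → MvPolynomial V K))) :
    f ∈ (Ideal.span (Set.range (levelParam K u v n))).radical := by
  refine (Ideal.span_le.2 ?_ : Ideal.span (Set.range (X : V → MvPolynomial V K)) ≤ _) hf
  rintro _ ⟨x, rfl⟩
  have hx : levelParam K u v n x ∈ Ideal.span (Set.range (levelParam K u v n)) :=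
    Ideal.subset_span ⟨x, rfl⟩
  rw [levelParam] at hx
  split_ifs at hx
  · exact ⟨n + 1, hx⟩
  · exact Ideal.le_radical hx

variable {a : V → ℕ} {n : ℕ}

lemma koszulD_levelCochain_mem (h : IsOrderedMatching G u v)
    (ha₁ : ∀ i, a (u i) + a (v i) + 1 = n)
    (ha₂ : ∀ x y, G.Adj x y → s(x, y) ∉ omEdges u v → n ≤ a x + a y)
    {ρ : V → ℕ} (hρ : Function.Injective ρ) (huv : ∀ i, ρ (v i) = ρ (u i) + 1)
    (l : Fin s) (F : Finset V) :
    koszulD ρ (levelParam K u v n) (levelCochain K u v a l) F ∈ symbPow K G n := by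
  classical
  by_cases hF : ∃ j, j ≠ l ∧ u j ∈ F ∧ v j ∈ F
  · obtain ⟨j, hj, huj, hvj⟩ := hF
    have hne : u j ≠ v j := h.u_ne_v j j
    have hzero : ∀ y ∈ F, y ≠ u j → y ≠ v j → ¬ IsPartialTransversal u v l (F.erase y) := by
      intro y hy hyu hyv hP
      have := hP.2.2 j hj
      simp [huj, hvj, hyu.symm, hyv.symm] at this
    have hiff : IsPartialTransversal u v l (F.erase (u j)) ↔
        IsPartialTransversal u v l (F.erase (v j)) := by
      have hsub : ∀ y, y ∉ uncovered u v → (uncovered u v ⊆ F.erase y ↔ uncovered u v ⊆ F) :=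
        fun y hy => by simp [Finset.subset_erase, hy]
      refine and_congr ((hsub _ (u_notMem_uncovered j)).trans
        (hsub _ (v_notMem_uncovered j)).symm) (and_congr ?_ (forall₂_congr fun i _ => ?_))
      · simp [h.injective_u.eq_iff, h.injective_v.eq_iff, h.u_ne_v, (h.u_ne_v _ _).symm, hj.symm]
      · by_cases hij : i = j
        · subst hij
          simp [hne, hne.symm, huj, hvj]
        · simp [h.injective_u.eq_iff, h.injective_v.eq_iff, h.u_ne_v, (h.u_ne_v _ _).symm, hij]
    have hsum : koszulD ρ (levelParam K u v n) (levelCochain K u v a l) F = 0 := by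
      rw [koszulD, ← Finset.sum_subset (s₁ := {u j, v j})
        (by intro x hx; simp only [Finset.mem_insert, Finset.mem_singleton] at hx
            rcases hx with rfl | rfl <;> assumption),
        Finset.sum_pair hne, koszulSign_succ _ hρ (huv j) huj]
      · simp only [levelCochain, ← hiff]
        split_ifs with hP
        · rw [smul_eq_mul, smul_eq_mul, mul_assoc, mul_assoc,
            levelParam_mul_monomial a n huj (u_notMem_uncovered j),
            levelParam_mul_monomial a n hvj (v_notMem_uncovered j)]
          ring
        · simp
      · intro y hy hy'
        simp only [Finset.mem_insert, Finset.mem_singleton, not_or] at hy'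
        rw [levelCochain, if_neg (hzero y hy hy'.1 hy'.2), smul_zero]
    rw [hsum]
    exact Ideal.zero_mem _
  · push Not at hF
    refine Ideal.sum_mem _ fun y hy => ?_
    rw [smul_eq_mul, levelCochain]
    split_ifs with hP
    swap
    · simp
    have hyW : y ∉ uncovered u v := fun hyW => Finset.notMem_erase y F (hP.1 hyW)
    rw [mul_assoc, levelParam_mul_monomial a n hy hyW]
    refine Ideal.mul_mem_left _ _ (monomial_mem_symbPow (fun x x' hxx' => ?_) _)
    by_cases hM : s(x, x') ∈ omEdges u v
    · have hcov : ∀ i, u i ∈ F ∨ v i ∈ F := by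
        intro i
        by_contra! hcon
        by_cases hi : i = l
        · subst hi
          rcases mem_uncovered_or u v y with hy' | ⟨k, rfl⟩ | ⟨k, rfl⟩
          · exact hyW hy'
          · have hk : k ≠ i := fun hk => hcon.1 (hk ▸ hy)
            have := hP.2.2 k hk
            simp [hF k hk hy] at this
          · have hk : k ≠ i := fun hk => hcon.2 (hk ▸ hy)
            have := hP.2.2 k hk
            simp only [Finset.notMem_erase, not_false_eq_true, iff_true] at this
            exact hF k hk (Finset.mem_of_mem_erase this) hy
        · have := hP.2.2 i hi
          simp [hcon] at this
      have hlev : ∀ i, n ≤ levelDeg u v a F (u i) + levelDeg u v a F (v i) := by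
        intro i
        have h1 := ha₁ i
        rw [levelDeg_apply, levelDeg_apply]
        rcases hcov i with hi | hi
        · rw [if_pos ⟨hi, u_notMem_uncovered i⟩]
          omega
        · rw [if_pos (⟨hi, v_notMem_uncovered i⟩ : v i ∈ F ∧ _)]
          omega
      obtain ⟨i, ⟨rfl, rfl⟩ | ⟨rfl, rfl⟩⟩ := mk_mem_omEdges.1 hM
      · exact hlev i
      · rw [add_comm]
        exact hlev i
    · have := ha₂ x x' hxx' hM
      rw [levelDeg_apply, levelDeg_apply]
      omega

lemma coeff_levelDeg_eq_zero (h : IsOrderedMatching G u v)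
    (ha₁ : ∀ i, a (u i) + a (v i) + 1 = n) {F : Finset V} {i : Fin s} (hu : u i ∉ F)
    (hv : v i ∉ F) {f : MvPolynomial V K} (hf : f ∈ symbPow K G n) :
    coeff (levelDeg u v a F) f = 0 := by
  by_contra hcon
  have h1 := mem_symbPow.1 hf _ hcon _ _ (h.1.2 i)
  have h2 := ha₁ i
  rw [levelDeg_apply, levelDeg_apply, if_neg (fun h => hu h.1),
    if_neg (fun h => hv h.1 : ¬ (v i ∈ F ∧ _))] at h1
  omega

open Classical in
lemma exists_koszulD_sub_notMem (h : IsOrderedMatching G u v)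
    (ha₁ : ∀ i, a (u i) + a (v i) + 1 = n) (ha₂ : ∀ x ∈ uncovered u v, a x ≤ n)
    {ρ : V → ℕ} (hρ : Function.Injective ρ) (l : Fin s) (b : Finset V → MvPolynomial V K) :
    ∃ F, koszulD ρ (levelParam K u v n) b F - levelCochain K u v a l F ∉ symbPow K G n := by
  by_contra! hcon
  obtain ⟨β, hβ⟩ : ∃ β : Finset V → K, ∀ F, β F =
      if uncovered u v ⊆ F then coeff (levelDeg u v a F) (b F) else 0 := ⟨_, fun _ => rfl⟩
  have hβ0 : ∀ F, ∀ y ∈ uncovered u v, y ∉ F → β F = 0 := fun F y hy hyF => by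
    rw [hβ, if_neg fun hsub => hyF (hsub hy)]
  have hD : ∀ F, uncovered u v ⊆ F → ∀ i, u i ∉ F → v i ∉ F →
      koszulD ρ (1 : V → K) β F = if IsPartialTransversal u v l F then 1 else 0 := by
    intro F hF i hu hv
    have h1 := coeff_levelDeg_eq_zero h ha₁ hu hv (hcon F)
    rw [coeff_sub, sub_eq_zero] at h1
    have h2 : coeff (levelDeg u v a F) (levelCochain K u v a l F)
        = if IsPartialTransversal u v l F then 1 else 0 := by
      rw [levelCochain]
      split_ifs <;> simp
    rw [← h2, ← h1, koszulD, koszulD, coeff_sum]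
    refine Finset.sum_congr rfl fun y hy => ?_
    have hs : koszulSign (MvPolynomial V K) ρ y F = C (koszulSign K ρ y F) := by
      simp [koszulSign]
    rw [smul_eq_mul, smul_eq_mul, hs, mul_assoc, mul_assoc, coeff_C_mul,
      Pi.one_apply, one_mul]
    congr 1
    by_cases hyW : y ∈ uncovered u v
    · rw [coeff_levelParam_mul_of_mem a hyW (ha₂ y hyW),
        hβ0 _ y hyW (Finset.notMem_erase y F)]
    · rw [coeff_levelParam_mul a n hy hyW, hβ, if_pos (Finset.subset_erase.2 ⟨hF, hyW⟩)]
  obtain ⟨F₀, hF₀⟩ : ∃ F₀ : Finset V, F₀ = uncovered u v ∪ Finset.univ.image u := ⟨_, rfl⟩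
  have hu₀ : ∀ i, u i ∈ F₀ := fun i => by simp [hF₀]
  have hv₀ : ∀ i, v i ∉ F₀ := fun i => by
    simp [hF₀, v_notMem_uncovered i, h.u_ne_v]
  have hW₀ : uncovered u v ⊆ F₀ := hF₀ ▸ Finset.subset_union_left
  have hzero := koszulD_koszulD hρ (1 : V → K) β F₀
  rw [koszulD, Finset.sum_eq_single (u l)] at hzero
  · rw [hD (F₀.erase (u l)) (Finset.subset_erase.2 ⟨hW₀, u_notMem_uncovered l⟩) l
      (Finset.notMem_erase _ _) (fun hv => hv₀ l (Finset.mem_of_mem_erase hv)), if_pos] at hzero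
    · have := koszulSign_mul_self (R := K) ρ (u l) F₀
      simp only [Pi.one_apply, mul_one, smul_eq_mul] at hzero
      simp [hzero] at this
    · refine ⟨Finset.subset_erase.2 ⟨hW₀, u_notMem_uncovered l⟩, ⟨Finset.notMem_erase _ _,
        fun hv => hv₀ l (Finset.mem_of_mem_erase hv)⟩, fun i hi => ?_⟩
      simp [hu₀, hv₀, h.injective_u.eq_iff, hi]
  · intro y hy hyl
    convert smul_zero _
    rw [hF₀, Finset.mem_union, Finset.mem_image] at hy
    rcases hy with hy | ⟨i, -, rfl⟩
    · refine Finset.sum_eq_zero fun x hx => ?_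
      rw [hβ0 _ y hy fun hy' => Finset.notMem_erase y F₀ (Finset.mem_of_mem_erase hy'), smul_zero]
    · rw [hD (F₀.erase (u i)) (Finset.subset_erase.2 ⟨hW₀, u_notMem_uncovered i⟩) i
        (Finset.notMem_erase _ _) (fun hv => hv₀ i (Finset.mem_of_mem_erase hv)), if_neg]
      exact fun hP => hP.2.1.1 (Finset.mem_erase.2 ⟨hyl.symm, hu₀ l⟩)
  · exact fun hl => absurd (hu₀ l) hl

/-- An ordered matching with a compatible level function bounds the length of regular sequences
on the quotient by a symbolic power. -/
theorem length_add_le_of_isWeaklyRegular (h : IsOrderedMatching G u v) (l : Fin s)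
    (ha₁ : ∀ i, a (u i) + a (v i) + 1 = n)
    (ha₂ : ∀ x y, G.Adj x y → s(x, y) ∉ omEdges u v → n ≤ a x + a y)
    (ha₃ : ∀ x ∈ uncovered u v, a x ≤ n) {rs : List (MvPolynomial V K)}
    (hrs : ∀ f ∈ rs, f ∈ Ideal.span (Set.range (X : V → MvPolynomial V K)))
    (hreg : RingTheory.Sequence.IsWeaklyRegular (MvPolynomial V K ⧸ symbPow K G n) rs) :
    rs.length + s + 1 ≤ Fintype.card V := by
  obtain ⟨ρ, hρ, huv⟩ := exists_rank h.1.1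
  by_contra! hcon
  have hcard : s + s ≤ Fintype.card V := by
    have := Fintype.card_le_of_injective _ h.1.1
    simpa using this
  have hs : 0 < s := l.pos
  have hV := koszulVanish_of_isWeaklyRegular hρ rs hreg
    (fun f hf => mem_radical_span_levelParam (u := u) (v := v) n (hrs f hf))
    (i := Fintype.card V - s - 1) (by omega)
  have hc : IsCochain (Fintype.card V - s - 1)
      (fun F => (symbPow K G n).mkQ (levelCochain K u v a l F)) := by
    intro F hF
    have hP : IsPartialTransversal u v l F := by
      by_contra hP
      simp only [levelCochain, if_neg hP, map_zero] at hF
      exact hF rfl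
    have := hP.card_add h.1.1
    omega
  have hd : ∀ F, koszulD ρ (levelParam K u v n)
      (fun F => (symbPow K G n).mkQ (levelCochain K u v a l F)) F = 0 := by
    intro F
    rw [koszulD_comp, Submodule.mkQ_apply, Submodule.Quotient.mk_eq_zero]
    exact koszulD_levelCochain_mem h ha₁ ha₂ hρ huv l F
  obtain ⟨b, -, hb⟩ := hV _ hc hd
  choose b' hb' using fun F => (symbPow K G n).mkQ_surjective (b F)
  obtain ⟨F, hF⟩ := exists_koszulD_sub_notMem (K := K) h ha₁ ha₃ hρ l b'
  apply hF
  rw [← Submodule.Quotient.mk_eq_zero, ← Submodule.mkQ_apply, map_sub, sub_eq_zero,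
    ← koszulD_comp]
  exact (congrFun (congrArg (koszulD ρ _) (funext hb')) F).trans (hb F)

end Level

end DS

namespace DS

/-! ### The depth of the powers of the cover ideal -/

section Depth

variable {V : Type*} {G : SimpleGraph V} {s : ℕ} {u v : Fin s → V}

lemma IsOrderedMatching.add_le_card [Fintype V] (h : IsOrderedMatching G u v) :
    s + s ≤ Fintype.card V := by
  simpa using Fintype.card_le_of_injective _ h.1.1

lemma bddAbove_isOrderedMatching [Finite V] (G : SimpleGraph V) :
    BddAbove {s | ∃ u v : Fin s → V, IsOrderedMatching G u v} := by
  have := Fintype.ofFinite V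
  refine ⟨Fintype.card V, ?_⟩
  rintro s ⟨u, v, h⟩
  have := h.add_le_card
  omega

lemma IsOrderedMatching.le_nu0 [Finite V] (h : IsOrderedMatching G u v) : s ≤ nu0 G :=
  le_csSup (bddAbove_isOrderedMatching G) ⟨u, v, h⟩

lemma exists_isOrderedMatching_nu0 [Finite V] {x y : V} (hxy : G.Adj x y) :
    ∃ u v : Fin (nu0 G) → V, IsOrderedMatching G u v :=
  Nat.sSup_mem (s := {s | ∃ u v : Fin s → V, IsOrderedMatching G u v})
    ⟨1, _, _, isOrderedMatching_single hxy⟩ (bddAbove_isOrderedMatching G)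

lemma exists_isOrderedMatching_ellM_eq [Finite V] {x y : V} (hxy : G.Adj x y) :
    ∃ u v : Fin (nu0 G) → V, IsOrderedMatching G u v ∧ ellM G (omEdges u v) = ellG G := by
  obtain ⟨u, v, h⟩ := exists_isOrderedMatching_nu0 hxy
  exact Nat.sInf_mem (s := {n | ∃ u v : Fin (nu0 G) → V,
    IsOrderedMatching G u v ∧ ellM G (omEdges u v) = n}) ⟨_, u, v, h, rfl⟩

variable [Fintype V] [DecidableEq V]

lemma IsOrderedMatching.exists_degree (h : IsOrderedMatching G u v) {n : ℕ}
    (hn : ellM G (omEdges u v) ≤ 2 * n) :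
    ∃ a : V → ℕ, (∀ i, a (u i) + a (v i) + 1 = n) ∧
      (∀ x y, G.Adj x y → s(x, y) ∉ omEdges u v → n ≤ a x + a y) ∧
      ∀ x ∈ uncovered u v, a x ≤ n := by
  obtain ⟨p, hp₁, hp₂, hp₃⟩ := h.exists_level
  let a : V → ℕ :=
    Function.extend (Sum.elim u v) (Sum.elim p fun i => n - 1 - p i) fun _ => n
  have hu (i) : a (u i) = p i :=
    h.1.1.extend_apply (Sum.elim p fun i => n - 1 - p i) (fun _ => n) (Sum.inl i)
  have hv (i) : a (v i) = n - 1 - p i :=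
    h.1.1.extend_apply (Sum.elim p fun i => n - 1 - p i) (fun _ => n) (Sum.inr i)
  have hw (x) (hx : x ∈ uncovered u v) : a x = n := by
    refine Function.extend_apply' _ _ _ ?_
    rintro ⟨i | i, rfl⟩
    · exact u_notMem_uncovered i hx
    · exact v_notMem_uncovered i hx
  have huv (i j) (hij : G.Adj (u i) (v j)) (hM : s(u i, v j) ∉ omEdges u v) :
      n ≤ a (u i) + a (v j) := by
    have := hp₁ i j (by rintro rfl; exact hM ⟨i, rfl⟩) hij
    rw [hu, hv]
    omega
  refine ⟨a, fun i => ?_, fun x y hxy hM => ?_, fun x hx => (hw x hx).le⟩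
  · have := hp₂ i
    rw [hu, hv]
    omega
  · rcases mem_uncovered_or u v x with hx | ⟨i, rfl⟩ | ⟨i, rfl⟩
    · exact (hw x hx).ge.trans (Nat.le_add_right _ _)
    · rcases mem_uncovered_or u v y with hy | ⟨j, rfl⟩ | ⟨j, rfl⟩
      · exact (hw y hy).ge.trans (Nat.le_add_left _ _)
      · exact absurd hxy (h.2.1 i j)
      · exact huv i j hxy hM
    · rcases mem_uncovered_or u v y with hy | ⟨j, rfl⟩ | ⟨j, rfl⟩
      · exact (hw y hy).ge.trans (Nat.le_add_left _ _)
      · rw [add_comm]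
        exact huv j i hxy.symm (Sym2.eq_swap ▸ hM)
      · have := hp₃ i j hxy
        rw [hv, hv]
        omega

/-- The depth of the powers of the cover ideal of a bipartite graph from `ℓ(G) / 2` on. -/
theorem depthQ_coverIdeal_pow (K : Type*) [Field K] {c : V → Bool}
    (hc : ∀ ⦃x y⦄, G.Adj x y → c x ≠ c y) {x y : V} (hxy : G.Adj x y) {n : ℕ} (hn : 1 ≤ n)
    (hℓ : ellG G ≤ 2 * n) :
    depthQ K (coverIdeal K G ^ n) = Fintype.card V - nu0 G - 1 := by
  rw [coverIdeal_pow_eq_symbPow hc]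
  obtain ⟨u, v, h, hM⟩ := exists_isOrderedMatching_ellM_eq hxy
  obtain ⟨a, ha₁, ha₂, ha₃⟩ := h.exists_degree (hM.trans_le hℓ)
  refine IsGreatest.csSup_eq ⟨exists_isRegular_symbPow hc hxy hn fun s u v h' => h'.le_nu0, ?_⟩
  rintro _ ⟨rs, rfl, hrs, hreg⟩
  have := length_add_le_of_isWeaklyRegular h
    ⟨0, (isOrderedMatching_single hxy).le_nu0⟩ ha₁ ha₂ ha₃ hrs hreg.toIsWeaklyRegular
  omega

end Depth

end DS

/-- If `G` is bipartite with nonempty edge set, then `dst(J(G)) ≤ (ℓ(G) + 1)/2`, i.e.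
`2 · dst(J(G)) ≤ ℓ(G) + 1`. -/
theorem stmt_12 (K : Type*) [Field K] {r : ℕ} (G : SimpleGraph (Fin r))
    (hE : G.edgeSet.Nonempty)
    (hbip : ∃ c : Fin r → Bool, ∀ ⦃x y : Fin r⦄, G.Adj x y → c x ≠ c y) :
    2 * DS.dst K G ≤ DS.ellG G + 1 := by
  obtain ⟨e, he⟩ := hE
  induction e using Sym2.ind with | _ x y
  obtain ⟨c, hc⟩ := hbip
  obtain ⟨u, v, h, hM⟩ := DS.exists_isOrderedMatching_ellM_eq he
  obtain ⟨p, -, hp, -⟩ := h.exists_level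
  have hℓ : 2 * p ⟨0, (DS.isOrderedMatching_single he).le_nu0⟩ + 1 ≤ DS.ellG G := hM ▸ hp _
  have hdst : DS.dst K G ≤ (DS.ellG G + 1) / 2 := Nat.sInf_le ⟨by omega, fun m n hm hn => by
    rw [DS.depthQ_coverIdeal_pow K hc he (by omega) (by omega),
      DS.depthQ_coverIdeal_pow K hc he (by omega) (by omega)]⟩
  omega
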